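/- arXiv:math-ph/0311024 — 2 statements merged into one kernel-verified Lean document; each statement's English description precedes it below -/
import Mathlib

section
/- Fix an integer d ≥ 1 and let A be a compact subset of ℝ^d. Then, with the limit taken in the extended nonnegative reals [0,∞], lim_{N→∞} ℰ_d(A,N)/(N² log N) = H_d(B^d)/H_d(A), where B^d is the closed unit ball of ℝ^d (in particular the limit is +∞ when H_d(A) = 0). -/
open scoped ENNReal NNReal BigOperators Classical
open MeasureTheory Filter Metric Set Topology

/-- The Riesz `s`-energy of a finite configuration `ω`, valued in `[0,∞]`. -/
noncomputable def rieszEnergy {E : Type*} [PseudoEMetricSpace E] (s : ℝ) (ω : Finset E) : ℝ≥0∞ :=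
  ∑ x ∈ ω, ∑ y ∈ ω, if x = y then 0 else edist x y ^ (-s)

/-- The `N`-point minimal Riesz `s`-energy over a set `A` (infimum over all `N`-point
subsets of `A`; `∞` if there is none). -/
noncomputable def minRieszEnergy {E : Type*} [PseudoEMetricSpace E] (s : ℝ) (A : Set E)
    (N : ℕ) : ℝ≥0∞ :=
  ⨅ (ω : Finset E) (_ : ↑ω ⊆ A) (_ : ω.card = N), rieszEnergy s ω

/-- Polar coordinates for the lower Lebesgue integral of a radial function. -/
theorem lintegral_fun_norm_eq {E : Type*} [NormedAddCommGroup E] [NormedSpace ℝ E]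
    [FiniteDimensional ℝ E] [MeasurableSpace E] [BorelSpace E] [Nontrivial E]
    (μ : Measure E) [μ.IsAddHaarMeasure] {f : ℝ → ℝ≥0∞} (hf : Measurable f) :
    ∫⁻ x, f ‖x‖ ∂μ = Module.finrank ℝ E * μ (ball 0 1) *
      ∫⁻ y in Ioi (0 : ℝ), ENNReal.ofReal (y ^ (Module.finrank ℝ E - 1)) * f y := by
  have hm : MeasurableSet ({0}ᶜ : Set E) := (measurableSet_singleton _).compl
  calc
    ∫⁻ x, f ‖x‖ ∂μ = ∫⁻ x : ({0}ᶜ : Set E), f ‖x.1‖ ∂(μ.comap (↑)) := by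
      rw [lintegral_subtype_comap hm (fun x ↦ f ‖x‖), restrict_compl_singleton]
    _ = ∫⁻ x, f x.2 ∂(μ.toSphere.prod (.volumeIoiPow (Module.finrank ℝ E - 1))) := by
      rw [← μ.measurePreserving_homeomorphUnitSphereProd.lintegral_comp_emb
        (Homeomorph.measurableEmbedding _)]
      simp
    _ = μ.toSphere univ * ∫⁻ y, f y.1 ∂(Measure.volumeIoiPow (Module.finrank ℝ E - 1)) := by
      rw [lintegral_prod _ (by fun_prop)]
      simp [mul_comm]
    _ = _ := by
      rw [Measure.toSphere_apply_univ, Measure.volumeIoiPow,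
        lintegral_withDensity_eq_lintegral_mul _ (by fun_prop) (by fun_prop)]
      congr 1
      exact lintegral_subtype_comap measurableSet_Ioi
        (fun y : ℝ ↦ ENNReal.ofReal (y ^ (Module.finrank ℝ E - 1)) * f y)

/-- Polar coordinates for a radial function, with the radius on a logarithmic scale. -/
theorem lintegral_fun_norm_eq_exp {E : Type*} [NormedAddCommGroup E] [NormedSpace ℝ E]
    [FiniteDimensional ℝ E] [MeasurableSpace E] [BorelSpace E] [Nontrivial E]
    (μ : Measure E) [μ.IsAddHaarMeasure] {f : ℝ → ℝ≥0∞} (hf : Measurable f) :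
    ∫⁻ x, f ‖x‖ ∂μ = Module.finrank ℝ E * μ (ball 0 1) *
      ∫⁻ s : ℝ, ENNReal.ofReal (Real.exp (Module.finrank ℝ E * s)) * f (Real.exp s) := by
  rw [lintegral_fun_norm_eq μ hf]
  congr 1
  have := lintegral_image_eq_lintegral_abs_deriv_mul (s := univ) (f := Real.exp)
    (f' := Real.exp) MeasurableSet.univ (fun x _ ↦ (Real.hasDerivAt_exp x).hasDerivWithinAt)
    Real.exp_injective.injOn
    (fun y ↦ ENNReal.ofReal (y ^ (Module.finrank ℝ E - 1)) * f y)
  rw [image_univ, Real.range_exp, setLIntegral_univ] at this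
  rw [this]
  refine lintegral_congr fun s ↦ ?_
  rw [← mul_assoc, ← ENNReal.ofReal_mul (abs_nonneg _), abs_of_pos (Real.exp_pos s), ← pow_succ',
    Nat.sub_add_cancel Module.finrank_pos, Real.exp_nat_mul]

/-- The integral of `‖x‖ ^ (-dim)` over an annulus. -/
theorem lintegral_norm_rpow_annulus {E : Type*} [NormedAddCommGroup E] [NormedSpace ℝ E]
    [FiniteDimensional ℝ E] [MeasurableSpace E] [BorelSpace E] [Nontrivial E]
    (μ : Measure E) [μ.IsAddHaarMeasure] {a b : ℝ} (ha : 0 < a) (hb : 0 < b) :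
    ∫⁻ x, (Ioc a b).indicator
      (fun t ↦ ENNReal.ofReal t ^ (-(Module.finrank ℝ E : ℝ))) ‖x‖ ∂μ =
      Module.finrank ℝ E * μ (ball 0 1) * ENNReal.ofReal (Real.log b - Real.log a) := by
  have hm : Measurable ((Ioc a b).indicator
      (fun t ↦ ENNReal.ofReal t ^ (-(Module.finrank ℝ E : ℝ)))) :=
    Measurable.indicator (by fun_prop) measurableSet_Ioc
  rw [lintegral_fun_norm_eq_exp μ hm, ← Real.volume_Ioc, ← lintegral_indicator_one measurableSet_Ioc]
  congr 1
  refine lintegral_congr fun s ↦ ?_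
  by_cases h : s ∈ Ioc (Real.log a) (Real.log b)
  · have h' : Real.exp s ∈ Ioc a b :=
      ⟨(Real.log_lt_iff_lt_exp ha).1 h.1, (Real.le_log_iff_exp_le hb).1 h.2⟩
    rw [indicator_of_mem h, indicator_of_mem h', ENNReal.ofReal_rpow_of_pos (Real.exp_pos s),
      ← ENNReal.ofReal_mul (Real.exp_pos _).le, ← Real.exp_mul, ← Real.exp_add]
    simp [mul_comm]
  · have h' : Real.exp s ∉ Ioc a b := fun h' ↦
      h ⟨(Real.log_lt_iff_lt_exp ha).2 h'.1, (Real.le_log_iff_exp_le hb).2 h'.2⟩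
    rw [indicator_of_notMem h, indicator_of_notMem h', mul_zero]

open scoped Pointwise in
/-- The volume of the intersection of two balls of radius `r` depends only on `r` and on the
distance of the centres. -/
theorem exists_volume_ball_inter_ball_eq (d : ℕ) [NeZero d] :
    ∃ H : ℝ → ℝ≥0∞, Measurable H ∧
      (∀ (x y : EuclideanSpace ℝ (Fin d)) {r : ℝ}, 0 < r →
        volume (ball x r ∩ ball y r) = ENNReal.ofReal (r ^ d) * H (dist x y / r)) ∧
      ∫⁻ z : EuclideanSpace ℝ (Fin d), H ‖z‖ =
        volume (ball (0 : EuclideanSpace ℝ (Fin d)) 1) ^ 2 := by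
  obtain ⟨e, he⟩ := exists_norm_eq (EuclideanSpace ℝ (Fin d)) zero_le_one
  set S : Set (EuclideanSpace ℝ (Fin d) × EuclideanSpace ℝ (Fin d)) :=
    {p | dist p.2 0 < 1} ∩ {p | dist p.2 p.1 < 1} with hS
  have hSm : MeasurableSet S :=
    (measurableSet_lt (by fun_prop) (by fun_prop)).inter
      (measurableSet_lt (by fun_prop) (by fun_prop))
  have h_lens (z : EuclideanSpace ℝ (Fin d)) : Prod.mk z ⁻¹' S = ball 0 1 ∩ ball z 1 := rfl
  have h_rot (z w : EuclideanSpace ℝ (Fin d)) (h : ‖z‖ = ‖w‖) :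
      volume (ball 0 1 ∩ ball z 1) = volume (ball 0 1 ∩ ball w 1) := by
    let R := (ℝ ∙ (w - z))ᗮ.reflection
    have hR : R w = z := Submodule.reflection_sub h.symm
    rw [← (R.measurePreserving).measure_preimage
      (measurableSet_ball.inter measurableSet_ball).nullMeasurableSet, preimage_inter, ← hR,
      R.preimage_ball, R.preimage_ball]
    simp
  have h_norm (z : EuclideanSpace ℝ (Fin d)) :
      volume (ball 0 1 ∩ ball (‖z‖ • e) 1) = volume (ball 0 1 ∩ ball z 1) :=
    h_rot _ _ (by simp [norm_smul, he])
  refine ⟨fun t ↦ volume (ball 0 1 ∩ ball (t • e) 1), ?_, fun x y r hr ↦ ?_, ?_⟩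
  · exact (measurable_measure_prodMk_left hSm).comp (by fun_prop : Measurable fun t : ℝ ↦ t • e)
  · have h1 : dist x y / r = ‖r⁻¹ • (y - x)‖ := by
      rw [norm_smul, norm_inv, Real.norm_of_nonneg hr.le, dist_comm, dist_eq_norm]
      ring
    have h2 : ball x r ∩ ball y r =
        x +ᵥ (r • (ball (0 : EuclideanSpace ℝ (Fin d)) 1 ∩ ball (r⁻¹ • (y - x)) 1)) := by
      rw [smul_set_inter₀ hr.ne', _root_.smul_ball hr.ne', _root_.smul_ball hr.ne',
        smul_inv_smul₀ hr.ne', vadd_set_inter, Metric.vadd_ball, Metric.vadd_ball]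
      simp [abs_of_pos hr]
    beta_reduce
    rw [h1, h_norm, h2, measure_vadd, Measure.addHaar_smul, finrank_euclideanSpace_fin,
      abs_of_pos (pow_pos hr d)]
  · simp only [h_norm]
    simp only [← h_lens]
    rw [← Measure.prod_apply hSm, Measure.prod_apply_symm hSm]
    have (y : EuclideanSpace ℝ (Fin d)) : volume ((fun x ↦ (x, y)) ⁻¹' S) =
        (ball 0 1).indicator (fun _ ↦ volume (ball (0 : EuclideanSpace ℝ (Fin d)) 1)) y := by
      by_cases hy : y ∈ ball (0 : EuclideanSpace ℝ (Fin d)) 1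
      · rw [indicator_of_mem hy, ← Measure.addHaar_ball_center volume y 1]
        congr 1
        ext x
        simp [hS, dist_comm, mem_ball_zero_iff.1 hy]
      · rw [indicator_of_notMem hy]
        have : (fun x ↦ (x, y)) ⁻¹' S = ∅ := by
          ext x
          simp only [hS, mem_preimage, mem_empty_iff_false, iff_false]
          exact fun h ↦ hy h.1
        rw [this, measure_empty]
    simp only [this]
    rw [lintegral_indicator measurableSet_ball, lintegral_const, Measure.restrict_apply_univ, sq]

/-- The Riesz kernel of exponent `d` is, up to a constant, a superposition over all scales of
normalized self-convolutions of indicators of balls. -/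
theorem lintegral_volume_ball_inter_ball (d : ℕ) [NeZero d] {x y : EuclideanSpace ℝ (Fin d)}
    (hxy : x ≠ y) :
    d * ∫⁻ s : ℝ, ENNReal.ofReal (Real.exp (-(2 * d * s))) *
        volume (ball x (Real.exp s) ∩ ball y (Real.exp s)) =
      volume (ball (0 : EuclideanSpace ℝ (Fin d)) 1) * edist x y ^ (-(d : ℝ)) := by
  obtain ⟨H, hHm, hH, hH_integral⟩ := exists_volume_ball_inter_ball_eq d
  have hd0 : 0 < dist x y := dist_pos.2 hxy
  set v := volume (ball (0 : EuclideanSpace ℝ (Fin d)) 1) with hv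
  have hv0 : v ≠ 0 := (measure_ball_pos _ _ one_pos).ne'
  have hvt : v ≠ ∞ := measure_ball_lt_top.ne
  rw [lintegral_fun_norm_eq_exp volume hHm, finrank_euclideanSpace_fin, ← hv] at hH_integral
  have h1 : d * ∫⁻ s : ℝ, ENNReal.ofReal (Real.exp (d * s)) * H (Real.exp s) = v := by
    rw [← ENNReal.mul_right_inj hv0 hvt, ← mul_assoc, mul_comm v, hH_integral, sq]
  have h2 : ∫⁻ s : ℝ, ENNReal.ofReal (Real.exp (-(2 * d * s))) *
        volume (ball x (Real.exp s) ∩ ball y (Real.exp s)) =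
      edist x y ^ (-(d : ℝ)) *
        ∫⁻ s : ℝ, ENNReal.ofReal (Real.exp (d * s)) * H (Real.exp s) := by
    rw [← lintegral_const_mul _ (by fun_prop)]
    refine (lintegral_neg_eq_self _).symm.trans
      ((lintegral_add_right_eq_self _ (-Real.log (dist x y))).symm.trans ?_)
    refine lintegral_congr fun s ↦ ?_
    rw [hH x y (Real.exp_pos _), ← mul_assoc, ← mul_assoc, ← ENNReal.ofReal_mul (Real.exp_pos _).le,
      edist_dist, ENNReal.ofReal_rpow_of_pos hd0, ← ENNReal.ofReal_mul (by positivity),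
      Real.rpow_def_of_pos hd0, ← Real.exp_nat_mul, ← Real.exp_add, ← Real.exp_add]
    congr 2
    · congr 1
      ring_nf
    · nth_rewrite 1 [← Real.exp_log hd0]
      rw [← Real.exp_sub]
      congr 1
      ring
  rw [h2, mul_left_comm, h1, mul_comm]

/-- A second-moment bound for a finite family of subsets of a given set. -/
theorem sq_sum_measure_le {α ι : Type*} [MeasurableSpace α] (μ : Measure α) (ω : Finset ι)
    {B : ι → Set α} (hB : ∀ i, MeasurableSet (B i)) {T : Set α} (hBT : ∀ i ∈ ω, B i ⊆ T) :
    (∑ i ∈ ω, μ (B i)) ^ 2 ≤ μ T * ∑ i ∈ ω, ∑ j ∈ ω, μ (B i ∩ B j) := by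
  set f : α → ℝ≥0∞ := fun u ↦ ∑ i ∈ ω, (B i).indicator 1 u with hf
  have hm (i : ι) : Measurable ((B i).indicator (1 : α → ℝ≥0∞)) :=
    measurable_one.indicator (hB i)
  have hfm : Measurable f := Finset.measurable_sum _ fun i _ ↦ hm i
  have h1 : ∫⁻ u in T, f u ∂μ = ∑ i ∈ ω, μ (B i) := by
    rw [lintegral_finsetSum _ fun i _ ↦ hm i]
    refine Finset.sum_congr rfl fun i hi ↦ ?_
    rw [lintegral_indicator_one (hB i), Measure.restrict_apply (hB i),
      inter_eq_self_of_subset_left (hBT i hi)]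
  have h2 : ∫⁻ u in T, f u ^ (2 : ℝ) ∂μ ≤ ∑ i ∈ ω, ∑ j ∈ ω, μ (B i ∩ B j) := by
    refine (setLIntegral_le_lintegral T _).trans_eq ?_
    have (u : α) : f u ^ (2 : ℝ) = ∑ i ∈ ω, ∑ j ∈ ω, (B i ∩ B j).indicator 1 u := by
      simp only [hf, ENNReal.rpow_two, sq, Finset.sum_mul_sum, inter_indicator_one, Pi.mul_apply]
    simp only [this]
    have hm2 (i j : ι) : Measurable ((B i ∩ B j).indicator (1 : α → ℝ≥0∞)) :=
      measurable_one.indicator ((hB i).inter (hB j))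
    rw [lintegral_finsetSum _ fun i _ ↦ Finset.measurable_sum _ fun j _ ↦ hm2 i j]
    refine Finset.sum_congr rfl fun i _ ↦ ?_
    rw [lintegral_finsetSum _ fun j _ ↦ hm2 i j]
    exact Finset.sum_congr rfl fun j _ ↦ lintegral_indicator_one ((hB i).inter (hB j))
  have h3 := ENNReal.lintegral_mul_le_Lp_mul_Lq (μ.restrict T) Real.HolderConjugate.two_two
    hfm.aemeasurable (aemeasurable_const (b := (1 : ℝ≥0∞)))
  simp only [Pi.mul_apply, mul_one, ENNReal.one_rpow, lintegral_const, one_mul,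
    Measure.restrict_apply_univ, h1] at h3
  calc (∑ i ∈ ω, μ (B i)) ^ 2
      ≤ ((∫⁻ u in T, f u ^ (2 : ℝ) ∂μ) ^ (1 / 2 : ℝ) * μ T ^ (1 / 2 : ℝ)) ^ 2 := by gcongr
    _ = (∫⁻ u in T, f u ^ (2 : ℝ) ∂μ) * μ T := by
      rw [mul_pow, ← ENNReal.rpow_mul_natCast, ← ENNReal.rpow_mul_natCast]
      norm_num
    _ ≤ _ := by
      rw [mul_comm]
      gcongr

/-- A lower bound for the Riesz `d`-energy of a finite subset of `A` in terms of the volume of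
a neighbourhood of `A`. -/
theorem volume_mul_log_le_rieszEnergy (d : ℕ) [NeZero d] {A : Set (EuclideanSpace ℝ (Fin d))}
    {ω : Finset (EuclideanSpace ℝ (Fin d))} (hω : ↑ω ⊆ A) (hN : 0 < ω.card) {ρ : ℝ} (hρ : 0 < ρ) :
    ENNReal.ofReal (Real.log ω.card + d * Real.log ρ) *
        ((ω.card : ℝ≥0∞) ^ 2 * volume (ball (0 : EuclideanSpace ℝ (Fin d)) 1)) ≤
      volume (thickening ρ A) * ((ω.card : ℝ≥0∞) ^ 2 + rieszEnergy (d : ℝ) ω) := by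
  set v := volume (ball (0 : EuclideanSpace ℝ (Fin d)) 1) with hv
  have hv0 : v ≠ 0 := (measure_ball_pos _ _ one_pos).ne'
  have hvt : v ≠ ∞ := measure_ball_lt_top.ne
  have hd : (0 : ℝ) < d := Nat.cast_pos.2 (NeZero.pos d)
  set N := ω.card with hNdef
  have hN' : (0 : ℝ) < N := Nat.cast_pos.2 hN
  set τ := volume (thickening ρ A) with hτ
  set K : EuclideanSpace ℝ (Fin d) → EuclideanSpace ℝ (Fin d) → ℝ → ℝ≥0∞ := fun x y s ↦
    ENNReal.ofReal (Real.exp (-(2 * d * s))) *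
        volume (ball x (Real.exp s) ∩ ball y (Real.exp s)) with hK
  have hball (x : EuclideanSpace ℝ (Fin d)) (s : ℝ) :
      volume (ball x (Real.exp s)) = ENNReal.ofReal (Real.exp (d * s)) * v := by
    rw [Measure.addHaar_ball_of_pos _ _ (Real.exp_pos s), finrank_euclideanSpace_fin,
      Real.exp_nat_mul]
  have hKm (x y : EuclideanSpace ℝ (Fin d)) : Measurable (K x y) := by
    obtain ⟨H, hHm, hH, -⟩ := exists_volume_ball_inter_ball_eq d
    simp only [hK, fun s ↦ hH x y (Real.exp_pos s)]
    fun_prop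
  have hpt (s : ℝ) (hs : s < Real.log ρ) : (N : ℝ≥0∞) ^ 2 * v ^ 2 ≤
      τ * (N * v * ENNReal.ofReal (Real.exp (-d * s)) +
        ∑ x ∈ ω, ∑ y ∈ ω, if x = y then 0 else K x y s) := by
    have h1 := sq_sum_measure_le volume ω (B := fun x ↦ ball x (Real.exp s))
      (fun _ ↦ measurableSet_ball) (T := thickening ρ A) fun x hx ↦
        (ball_subset_ball ((Real.lt_log_iff_exp_lt hρ).1 hs).le).trans
          (ball_subset_thickening (hω hx) ρ)
    simp only [hball, Finset.sum_const, nsmul_eq_mul, ← hNdef] at h1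
    have h2 : ENNReal.ofReal (Real.exp (-(2 * d * s))) *
        ENNReal.ofReal (Real.exp (d * s)) ^ 2 = 1 := by
      rw [← ENNReal.ofReal_pow (Real.exp_pos _).le, ← ENNReal.ofReal_mul (Real.exp_pos _).le,
        ← Real.exp_nat_mul, ← Real.exp_add]
      simp [mul_assoc]
    calc (N : ℝ≥0∞) ^ 2 * v ^ 2
        = ENNReal.ofReal (Real.exp (-(2 * d * s))) *
          (N * (ENNReal.ofReal (Real.exp (d * s)) * v)) ^ 2 := by
          rw [mul_pow, mul_pow, mul_left_comm, ← mul_assoc (ENNReal.ofReal _), h2, one_mul]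
      _ ≤ ENNReal.ofReal (Real.exp (-(2 * d * s))) * (τ * ∑ x ∈ ω, ∑ y ∈ ω,
          volume (ball x (Real.exp s) ∩ ball y (Real.exp s))) := by gcongr
      _ = τ * ∑ x ∈ ω, ∑ y ∈ ω, K x y s := by
          rw [mul_left_comm]
          simp only [Finset.mul_sum, hK]
      _ = _ := by
          congr 1
          have h3 (x : EuclideanSpace ℝ (Fin d)) (hx : x ∈ ω) : ∑ y ∈ ω, K x y s =
              v * ENNReal.ofReal (Real.exp (-d * s)) +
                ∑ y ∈ ω, if x = y then 0 else K x y s := by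
            have h4 : K x x s = v * ENNReal.ofReal (Real.exp (-d * s)) := by
              simp only [hK, inter_self, hball]
              rw [← mul_assoc, ← ENNReal.ofReal_mul (Real.exp_pos _).le, ← Real.exp_add, mul_comm]
              congr 3
              ring
            rw [← h4, ← Finset.add_sum_erase ω _ hx,
              ← Finset.add_sum_erase ω (fun y ↦ if x = y then 0 else K x y s) hx, if_pos rfl,
              zero_add]
            congr 1
            exact Finset.sum_congr rfl fun y hy ↦ (if_neg (Finset.ne_of_mem_erase hy).symm).symm
          rw [Finset.sum_congr rfl h3, Finset.sum_add_distrib, Finset.sum_const, nsmul_eq_mul,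
            mul_assoc]
  set σ : ℝ := -(Real.log N / d) with hσ
  have hexp : d * ∫⁻ s in Ioo σ (Real.log ρ), ENNReal.ofReal (Real.exp (-d * s)) ≤ N := by
    calc d * ∫⁻ s in Ioo σ (Real.log ρ), ENNReal.ofReal (Real.exp (-d * s))
        ≤ d * ∫⁻ s in Ioi σ, ENNReal.ofReal (Real.exp (-d * s)) := by
          gcongr
          exact Ioo_subset_Ioi_self
      _ = N := by
          rw [← ofReal_integral_eq_lintegral_ofReal (integrableOn_exp_mul_Ioi (neg_lt_zero.2 hd) σ)
            (ae_of_all _ fun _ ↦ (Real.exp_pos _).le), integral_exp_mul_Ioi (neg_lt_zero.2 hd),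
            ← ENNReal.ofReal_natCast, ← ENNReal.ofReal_mul hd.le, ← ENNReal.ofReal_natCast]
          congr 1
          have : -(d : ℝ) * σ = Real.log N := by
            rw [hσ]
            field_simp
          rw [this, Real.exp_log hN']
          field_simp
  have h_integrated : d * ((N : ℝ≥0∞) ^ 2 * v ^ 2 * ENNReal.ofReal (Real.log ρ - σ)) ≤
      τ * (N ^ 2 * v + v * rieszEnergy (d : ℝ) ω) := by
    calc d * ((N : ℝ≥0∞) ^ 2 * v ^ 2 * ENNReal.ofReal (Real.log ρ - σ))
        = d * ∫⁻ s in Ioo σ (Real.log ρ), (N : ℝ≥0∞) ^ 2 * v ^ 2 := by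
          rw [setLIntegral_const, Real.volume_Ioo]
      _ ≤ d * ∫⁻ s in Ioo σ (Real.log ρ), τ * (N * v * ENNReal.ofReal (Real.exp (-d * s)) +
        ∑ x ∈ ω, ∑ y ∈ ω, if x = y then 0 else K x y s) := by
          gcongr 1
          exact setLIntegral_mono' measurableSet_Ioo fun s hs ↦ hpt s hs.2
      _ = τ * (N * v * (d * ∫⁻ s in Ioo σ (Real.log ρ), ENNReal.ofReal (Real.exp (-d * s))) +
        ∑ x ∈ ω, ∑ y ∈ ω, if x = y then 0 else d * ∫⁻ s in Ioo σ (Real.log ρ), K x y s) := by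
          have hm (x y : EuclideanSpace ℝ (Fin d)) :
              Measurable fun s ↦ if x = y then 0 else K x y s := by
            split_ifs
            · exact measurable_const
            · exact hKm x y
          have hm' (x : EuclideanSpace ℝ (Fin d)) :
              Measurable fun s ↦ ∑ y ∈ ω, if x = y then 0 else K x y s :=
            Finset.measurable_sum _ fun y _ ↦ hm x y
          rw [lintegral_const_mul, lintegral_add_left (by fun_prop),
            lintegral_const_mul _ (by fun_prop), lintegral_finsetSum _ fun x _ ↦ hm' x,
            mul_left_comm, mul_add, mul_left_comm (d : ℝ≥0∞), Finset.mul_sum]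
          · congr 2
            refine Finset.sum_congr rfl fun x _ ↦ ?_
            rw [lintegral_finsetSum _ fun y _ ↦ hm x y, Finset.mul_sum]
            refine Finset.sum_congr rfl fun y _ ↦ ?_
            split_ifs <;> simp
          · exact (by fun_prop : Measurable _).add (Finset.measurable_sum _ fun x _ ↦ hm' x)
      _ ≤ τ * (N * v * N +
        ∑ x ∈ ω, ∑ y ∈ ω, if x = y then 0 else v * edist x y ^ (-(d : ℝ))) := by
          gcongr with x _ y _
          split_ifs with hxy
          · exact le_rfl
          · rw [← lintegral_volume_ball_inter_ball d hxy]
            gcongr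
            exact Measure.restrict_le_self
      _ = _ := by
          simp only [rieszEnergy, Finset.mul_sum, mul_ite, mul_zero]
          congr 2
          ring
  rw [← ENNReal.mul_le_mul_iff_right hv0 hvt]
  calc v * (ENNReal.ofReal (Real.log N + d * Real.log ρ) * ((N : ℝ≥0∞) ^ 2 * v))
      = d * ((N : ℝ≥0∞) ^ 2 * v ^ 2 * ENNReal.ofReal (Real.log ρ - σ)) := by
        have : Real.log N + d * Real.log ρ = d * (Real.log ρ - σ) := by
          rw [hσ]
          field_simp
          ring
        rw [this, ENNReal.ofReal_mul hd.le, ENNReal.ofReal_natCast]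
        ring
    _ ≤ _ := h_integrated
    _ = _ := by ring

theorem rieszEnergy_cons {E : Type*} [PseudoEMetricSpace E] (s : ℝ) {ω : Finset E} {x : E}
    (hx : x ∉ ω) :
    rieszEnergy s (ω.cons x hx) = rieszEnergy s ω + 2 * ∑ y ∈ ω, edist x y ^ (-s) := by
  have h1 : ∑ y ∈ ω, (if x = y then 0 else edist x y ^ (-s)) = ∑ y ∈ ω, edist x y ^ (-s) :=
    Finset.sum_congr rfl fun y hy ↦ if_neg (ne_of_mem_of_not_mem hy hx).symm
  have h2 : ∑ y ∈ ω, (if y = x then 0 else edist y x ^ (-s)) = ∑ y ∈ ω, edist x y ^ (-s) :=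
    Finset.sum_congr rfl fun y hy ↦ by
      rw [if_neg (ne_of_mem_of_not_mem hy hx), edist_comm]
  simp only [rieszEnergy, Finset.sum_cons, if_true, zero_add, Finset.sum_add_distrib, h1, h2]
  ring

/-- If the `ε`-balls around the points of `ω` cover little of `A`, then `A` contains a further
point at which the Riesz potential of `ω` is small. -/
theorem exists_notMem_sum_edist_rpow_le (d : ℕ) [NeZero d] {A : Set (EuclideanSpace ℝ (Fin d))}
    (hA : MeasurableSet A) (hAt : volume A ≠ ∞) {ω : Finset (EuclideanSpace ℝ (Fin d))}
    (hω : ↑ω ⊆ A) {ε D : ℝ} (hε : 0 < ε) (hD : 0 < D) (hAD : ∀ x ∈ A, ∀ y ∈ A, dist x y ≤ D)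
    {η : ℝ≥0∞} (hη : ω.card * volume (closedBall (0 : EuclideanSpace ℝ (Fin d)) ε) ≤ η)
    (hηA : η < volume A) :
    ∃ x ∈ A, x ∉ ω ∧ ∑ y ∈ ω, edist x y ^ (-(d : ℝ)) ≤
      ω.card * (d * volume (ball (0 : EuclideanSpace ℝ (Fin d)) 1) *
        ENNReal.ofReal (Real.log D - Real.log ε) / (volume A - η)) := by
  set U : Set (EuclideanSpace ℝ (Fin d)) := ⋃ y ∈ ω, closedBall y ε with hU
  have hUm : MeasurableSet U := Finset.measurableSet_biUnion _ fun _ _ ↦ measurableSet_closedBall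
  have hUη : volume U ≤ η := by
    refine (measure_biUnion_finset_le ω _).trans ?_
    simpa [Measure.addHaar_closedBall_center] using hη
  have hvol : volume A - η ≤ volume (A \ U) :=
    (tsub_le_tsub_left hUη _).trans (le_measure_sdiff)
  have hpos : volume A - η ≠ 0 := (tsub_pos_of_lt hηA).ne'
  have hfm : Measurable fun x : EuclideanSpace ℝ (Fin d) ↦ ∑ y ∈ ω, edist x y ^ (-(d : ℝ)) := by
    fun_prop
  obtain ⟨x, hx, hxle⟩ := exists_le_setLAverage (μ := volume) (s := A \ U)
    (fun h ↦ hpos (le_zero_iff.1 (h ▸ hvol))) (measure_ne_top_of_subset sdiff_subset hAt)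
    hfm.aemeasurable
  refine ⟨x, hx.1, fun h ↦ hx.2 (mem_biUnion h (mem_closedBall_self hε.le)), hxle.trans ?_⟩
  rw [setLAverage_eq, ← mul_div_assoc]
  gcongr
  rw [lintegral_finsetSum _ fun y _ ↦ by fun_prop, ← nsmul_eq_mul]
  refine Finset.sum_le_card_nsmul _ _ _ fun y hy ↦ ?_
  have hann := lintegral_norm_rpow_annulus (volume : Measure (EuclideanSpace ℝ (Fin d))) hε hD
  rw [← lintegral_sub_right_eq_self _ y, finrank_euclideanSpace_fin] at hann
  rw [← hann, ← lintegral_indicator (hA.diff hUm)]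
  refine lintegral_mono (indicator_le fun z hz ↦ ?_)
  have hmem : ‖z - y‖ ∈ Ioc ε D := by
    rw [← dist_eq_norm]
    refine ⟨?_, hAD _ hz.1 _ (hω hy)⟩
    by_contra! h
    exact hz.2 (mem_biUnion hy h)
  rw [indicator_of_mem hmem, edist_dist, dist_eq_norm]

/-- A greedy choice of points bounds the minimal Riesz `d`-energy of a set of positive volume. -/
theorem minRieszEnergy_le_of_volume (d : ℕ) [NeZero d] {A : Set (EuclideanSpace ℝ (Fin d))}
    (hA : MeasurableSet A) (hAt : volume A ≠ ∞) {ε D : ℝ} (hε : 0 < ε) (hD : 0 < D)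
    (hAD : ∀ x ∈ A, ∀ y ∈ A, dist x y ≤ D) {N : ℕ} {η : ℝ≥0∞}
    (hη : N * volume (closedBall (0 : EuclideanSpace ℝ (Fin d)) ε) ≤ η) (hηA : η < volume A) :
    minRieszEnergy (d : ℝ) A N ≤ (N : ℝ≥0∞) ^ 2 *
      (d * volume (ball (0 : EuclideanSpace ℝ (Fin d)) 1) *
        ENNReal.ofReal (Real.log D - Real.log ε) / (volume A - η)) := by
  set M := d * volume (ball (0 : EuclideanSpace ℝ (Fin d)) 1) *
        ENNReal.ofReal (Real.log D - Real.log ε) / (volume A - η) with hM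
  have key (k : ℕ) (hk : k ≤ N) : ∃ ω : Finset (EuclideanSpace ℝ (Fin d)), ↑ω ⊆ A ∧ ω.card = k ∧
      rieszEnergy (d : ℝ) ω ≤ (k : ℝ≥0∞) ^ 2 * M := by
    induction k with
    | zero => exact ⟨∅, by simp, by simp, by simp [rieszEnergy]⟩
    | succ k ih =>
      obtain ⟨ω, hωA, hωk, hωE⟩ := ih (by omega)
      obtain ⟨x, hxA, hxω, hx⟩ := exists_notMem_sum_edist_rpow_le d hA hAt hωA hε hD hAD
        (η := η) (le_trans (by rw [hωk]; gcongr; omega) hη) hηA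
      refine ⟨ω.cons x hxω, ?_, by rw [Finset.card_cons, hωk], ?_⟩
      · rw [Finset.coe_cons]
        exact insert_subset hxA hωA
      · rw [rieszEnergy_cons]
        rw [hωk, ← hM] at hx
        calc _ ≤ (k : ℝ≥0∞) ^ 2 * M + 2 * (k * M) := by gcongr
          _ = ((k : ℝ≥0∞) ^ 2 + 2 * k) * M := by ring
          _ ≤ (((k : ℝ≥0∞) ^ 2 + 2 * k) + 1) * M := mul_le_mul_left le_self_add _
          _ = _ := by push_cast; ring
  obtain ⟨ω, hωA, hωN, hωE⟩ := key N le_rfl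
  exact (iInf₂_le_of_le ω hωA (iInf_le_of_le hωN le_rfl)).trans hωE

theorem tendsto_add_div_log_natCast (α C : ℝ) :
    Tendsto (fun N : ℕ ↦ (α * Real.log N + C) / Real.log N) atTop (𝓝 α) := by
  have hlog : Tendsto (fun N : ℕ ↦ Real.log N) atTop atTop :=
    Real.tendsto_log_atTop.comp tendsto_natCast_atTop_atTop
  have h : Tendsto (fun N : ℕ ↦ α + C / Real.log N) atTop (𝓝 (α + 0)) :=
    tendsto_const_nhds.add (hlog.const_div_atTop C)
  rw [add_zero] at h
  refine h.congr' ?_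
  filter_upwards [hlog.eventually_gt_atTop 0] with N hN
  field_simp

/-- The upper estimate in the asymptotics of the minimal Riesz `d`-energy. -/
theorem eventually_minRieszEnergy_div_lt (d : ℕ) [NeZero d]
    {A : Set (EuclideanSpace ℝ (Fin d))} (hA : IsCompact A) {c : ℝ≥0∞}
    (hc : volume (ball (0 : EuclideanSpace ℝ (Fin d)) 1) / volume A < c) :
    ∀ᶠ N : ℕ in atTop,
      minRieszEnergy (d : ℝ) A N / ENNReal.ofReal ((N : ℝ) ^ 2 * Real.log N) < c := by
  have hd : (0 : ℝ) < d := Nat.cast_pos.2 (NeZero.pos d)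
  have hAt : volume A ≠ ∞ := hA.measure_lt_top.ne
  set v := (volume (ball (0 : EuclideanSpace ℝ (Fin d)) 1)).toReal with hv
  have hvt : volume (ball (0 : EuclideanSpace ℝ (Fin d)) 1) ≠ ∞ := measure_ball_lt_top.ne
  have hv0 : 0 < v := ENNReal.toReal_pos (measure_ball_pos _ _ one_pos).ne' hvt
  have hvv : volume (ball (0 : EuclideanSpace ℝ (Fin d)) 1) = ENNReal.ofReal v :=
    (ENNReal.ofReal_toReal hvt).symm
  set V := (volume A).toReal with hV
  have hVV : volume A = ENNReal.ofReal V := (ENNReal.ofReal_toReal hAt).symm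
  have hV0 : 0 < V := by
    refine ENNReal.toReal_pos (fun h ↦ ?_) hAt
    rw [h, ENNReal.div_zero (measure_ball_pos _ _ one_pos).ne'] at hc
    exact not_top_lt hc
  obtain ⟨D, hD, hAD⟩ : ∃ D : ℝ, 0 < D ∧ ∀ x ∈ A, ∀ y ∈ A, dist x y ≤ D :=
    ⟨diam A + 1, by positivity, fun x hx y hy ↦
      (dist_le_diam_of_mem hA.isBounded hx hy).trans (by linarith)⟩
  have hlim : Tendsto (fun r : ℝ ↦ ENNReal.ofReal (v / (V - v * r ^ d))) (𝓝[>] 0)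
      (𝓝 (ENNReal.ofReal (v / V))) := by
    refine ENNReal.tendsto_ofReal (tendsto_nhdsWithin_of_tendsto_nhds ?_)
    have : ContinuousAt (fun r : ℝ ↦ v / (V - v * r ^ d)) 0 :=
      ContinuousAt.div (by fun_prop) (by fun_prop) (by simp [NeZero.ne d, hV0.ne'])
    simpa [ContinuousAt, NeZero.ne d] using this
  have hlim2 : Tendsto (fun r : ℝ ↦ v * r ^ d) (𝓝[>] 0) (𝓝 0) := by
    refine tendsto_nhdsWithin_of_tendsto_nhds ?_
    have : ContinuousAt (fun r : ℝ ↦ v * r ^ d) 0 := by fun_prop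
    simpa [ContinuousAt, NeZero.ne d] using this
  rw [hvv, hVV, ← ENNReal.ofReal_div_of_pos hV0] at hc
  obtain ⟨r, hrc, hrV, hr⟩ := ((hlim.eventually_lt_const hc).and
    ((hlim2.eventually_lt_const hV0).and self_mem_nhdsWithin)).exists
  have hr : 0 < r := hr
  have hW : 0 < V - v * r ^ d := sub_pos.2 hrV
  have hlog : Tendsto (fun N : ℕ ↦ Real.log N) atTop atTop :=
    Real.tendsto_log_atTop.comp tendsto_natCast_atTop_atTop
  filter_upwards [(ENNReal.tendsto_ofReal (tendsto_add_div_log_natCast (v / (V - v * r ^ d))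
    (v / (V - v * r ^ d) * (d * (Real.log D - Real.log r))))).eventually_lt_const hrc,
    eventually_gt_atTop 0, hlog.eventually_gt_atTop 0,
    hlog.eventually_gt_atTop (-(d * (Real.log D - Real.log r)))] with N hN hN0 hNlog hNlog'
  refine lt_of_le_of_lt ?_ hN
  have hN' : (0 : ℝ) < N := Nat.cast_pos.2 hN0
  set ε : ℝ := r * Real.exp (-(Real.log N / d)) with hε
  have hεpos : 0 < ε := by positivity
  have hεd : (N : ℝ) * ε ^ d = r ^ d := by
    rw [hε, mul_pow, ← Real.exp_nat_mul, mul_neg, mul_div_cancel₀ _ hd.ne', Real.exp_neg,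
      Real.exp_log hN']
    field_simp
  have hεlog : d * (Real.log D - Real.log ε) =
      Real.log N + d * (Real.log D - Real.log r) := by
    rw [hε, Real.log_mul hr.ne' (Real.exp_pos _).ne', Real.log_exp]
    field_simp
    ring
  have hη : N * volume (closedBall (0 : EuclideanSpace ℝ (Fin d)) ε) ≤
      ENNReal.ofReal (v * r ^ d) := by
    rw [Measure.addHaar_closedBall _ _ hεpos.le, finrank_euclideanSpace_fin, hvv,
      ← ENNReal.ofReal_natCast, ← ENNReal.ofReal_mul (by positivity),
      ← ENNReal.ofReal_mul (by positivity), ← mul_assoc, hεd, mul_comm]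
  have hle := minRieszEnergy_le_of_volume d hA.measurableSet hAt hεpos hD hAD hη
    (by rw [hVV]; exact (ENNReal.ofReal_lt_ofReal_iff hV0).2 hrV)
  refine (ENNReal.div_le_div_right hle _).trans_eq ?_
  have hlogpos : 0 ≤ Real.log D - Real.log ε := by
    refine le_of_mul_le_mul_left ?_ hd
    rw [hεlog]
    linarith
  rw [hvv, hVV, ← ENNReal.ofReal_sub _ (by positivity), ← ENNReal.ofReal_natCast,
    ← ENNReal.ofReal_natCast, ← ENNReal.ofReal_mul (by positivity),
    ← ENNReal.ofReal_mul (by positivity), ← ENNReal.ofReal_div_of_pos hW,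
    ← ENNReal.ofReal_pow (by positivity), ← ENNReal.ofReal_mul (by positivity),
    ← ENNReal.ofReal_div_of_pos (by positivity)]
  congr 1
  rw [mul_right_comm, hεlog]
  field_simp

/-- The lower estimate in the asymptotics of the minimal Riesz `d`-energy. -/
theorem eventually_lt_minRieszEnergy_div (d : ℕ) [NeZero d]
    {A : Set (EuclideanSpace ℝ (Fin d))} (hA : IsCompact A) {b : ℝ≥0∞}
    (hb : b < volume (ball (0 : EuclideanSpace ℝ (Fin d)) 1) / volume A) :
    ∀ᶠ N : ℕ in atTop,
      b < minRieszEnergy (d : ℝ) A N / ENNReal.ofReal ((N : ℝ) ^ 2 * Real.log N) := by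
  have hAt : volume A ≠ ∞ := hA.measure_lt_top.ne
  set v := (volume (ball (0 : EuclideanSpace ℝ (Fin d)) 1)).toReal with hv
  have hvt : volume (ball (0 : EuclideanSpace ℝ (Fin d)) 1) ≠ ∞ := measure_ball_lt_top.ne
  have hv0 : 0 < v := ENNReal.toReal_pos (measure_ball_pos _ _ one_pos).ne' hvt
  have hvv : volume (ball (0 : EuclideanSpace ℝ (Fin d)) 1) = ENNReal.ofReal v :=
    (ENNReal.ofReal_toReal hvt).symm
  have hdiv : Tendsto (fun t : ℝ≥0∞ ↦ volume (ball (0 : EuclideanSpace ℝ (Fin d)) 1) / t)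
      (𝓝[>] volume A) (𝓝 (volume (ball (0 : EuclideanSpace ℝ (Fin d)) 1) / volume A)) :=
    ENNReal.Tendsto.const_div (tendsto_id.mono_left nhdsWithin_le_nhds) (Or.inr hvt)
  have : (𝓝[>] volume A).NeBot := nhdsGT_neBot_of_exists_gt ⟨∞, hA.measure_lt_top⟩
  obtain ⟨τ, hbτ, hτt, hAτ⟩ := ((hdiv.eventually_const_lt hb).and
    (((eventually_lt_nhds hA.measure_lt_top).filter_mono nhdsWithin_le_nhds).and
      self_mem_nhdsWithin)).exists
  have hAτ : volume A < τ := hAτ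
  have hthick := tendsto_measure_thickening_of_isClosed (μ := volume)
    ⟨1, one_pos, (hA.isBounded.thickening.measure_lt_top).ne⟩ hA.isClosed
  obtain ⟨ρ, hρτ, hρ⟩ := ((hthick.eventually_lt_const hAτ).and self_mem_nhdsWithin).exists
  have hρ : 0 < ρ := hρ
  set t := τ.toReal with ht
  have ht0 : 0 < t := ENNReal.toReal_pos (pos_of_gt hAτ).ne' hτt.ne
  have hτ : τ = ENNReal.ofReal t := (ENNReal.ofReal_toReal hτt.ne).symm
  rw [hvv, hτ, ← ENNReal.ofReal_div_of_pos ht0] at hbτ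
  have hlog : Tendsto (fun N : ℕ ↦ Real.log N) atTop atTop :=
    Real.tendsto_log_atTop.comp tendsto_natCast_atTop_atTop
  filter_upwards [(ENNReal.tendsto_ofReal (tendsto_add_div_log_natCast (v / t)
    (v / t * (d * Real.log ρ) - 1))).eventually_const_lt hbτ,
    eventually_gt_atTop 0, hlog.eventually_gt_atTop 0] with N hN hN0 hNlog
  refine hN.trans_le ?_
  have hN' : (0 : ℝ) < N := Nat.cast_pos.2 hN0
  have hlow : ENNReal.ofReal ((N : ℝ) ^ 2 *
      (v / t * Real.log N + (v / t * (d * Real.log ρ) - 1))) ≤ minRieszEnergy (d : ℝ) A N := by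
    refine le_iInf fun ω ↦ le_iInf fun hω ↦ le_iInf fun hωN ↦ ?_
    have h := (volume_mul_log_le_rieszEnergy d hω (hωN ▸ hN0) hρ).trans
      (mul_le_mul_left hρτ.le _)
    rw [hωN] at h
    have h' := tsub_le_iff_left.2 (ENNReal.div_le_of_le_mul' h)
    refine le_trans (le_of_eq ?_) h'
    rw [hvv, hτ, ← ENNReal.ofReal_natCast, ← ENNReal.ofReal_pow hN'.le,
      ← ENNReal.ofReal_mul (by positivity), ← ENNReal.ofReal_mul' (by positivity),
      ← ENNReal.ofReal_div_of_pos ht0, ← ENNReal.ofReal_sub _ (by positivity)]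
    congr 1
    field_simp
    ring
  refine le_trans (le_of_eq ?_) (ENNReal.div_le_div_right hlow _)
  rw [← ENNReal.ofReal_div_of_pos (by positivity)]
  congr 1
  field_simp

/-- for compact `A ⊆ ℝ^d`, `ℰ_d(A,N)/(N² log N) → H_d(B^d)/H_d(A)` in `[0,∞]`. -/
theorem minRieszEnergy_div_tendsto_of_compact (d : ℕ) (hd : 1 ≤ d)
    (A : Set (EuclideanSpace ℝ (Fin d))) (hA : IsCompact A) :
    Tendsto
      (fun N : ℕ => minRieszEnergy (d : ℝ) A N / ENNReal.ofReal ((N : ℝ) ^ 2 * Real.log N))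
      atTop
      (𝓝 (volume (Metric.closedBall (0 : EuclideanSpace ℝ (Fin d)) 1) / volume A)) := by
  have : NeZero d := ⟨by omega⟩
  rw [Measure.addHaar_unitClosedBall_eq_addHaar_unitBall]
  exact tendsto_order.2 ⟨fun _ hb ↦ eventually_lt_minRieszEnergy_div d hA hb,
    fun _ hc ↦ eventually_minRieszEnergy_div_lt d hA hc⟩
end

section
/- Fix an integer d ≥ 1 and a real s > d. There exists a finite positive constant C_{s,d}, depending only on s and d, such that for every compact set A ⊆ ℝ^d, lim_{N→∞} ℰ_s(A,N)/N^{1+s/d} = C_{s,d}/H_d(A)^{s/d}, the limit taken in the extended nonnegative reals [0,∞] (so the limit is +∞ when H_d(A) = 0). -/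
open scoped ENNReal NNReal BigOperators Classical
open MeasureTheory Filter Metric Set Topology

section Energy

variable {E : Type*} [PseudoEMetricSpace E] {s : ℝ}

/-- The pair interaction of the Riesz `s`-energy, with self-interaction removed. -/
noncomputable def rieszKernel (s : ℝ) (x y : E) : ℝ≥0∞ :=
  if x = y then 0 else edist x y ^ (-s)

theorem rieszEnergy_eq_sum_rieszKernel (ω : Finset E) :
    rieszEnergy s ω = ∑ x ∈ ω, ∑ y ∈ ω, rieszKernel s x y := rfl

theorem rieszEnergy_mono {ω₁ ω₂ : Finset E} (h : ω₁ ⊆ ω₂) :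
    rieszEnergy s ω₁ ≤ rieszEnergy s ω₂ := by
  simp only [rieszEnergy_eq_sum_rieszKernel]
  exact (Finset.sum_le_sum fun x _ => Finset.sum_le_sum_of_subset h).trans
    (Finset.sum_le_sum_of_subset h)

theorem minRieszEnergy_le {A : Set E} {ω : Finset E} (h : ↑ω ⊆ A) :
    minRieszEnergy s A ω.card ≤ rieszEnergy s ω :=
  iInf_le_of_le ω (iInf_le_of_le h (iInf_le _ rfl))

theorem minRieszEnergy_le_of_le_card {A : Set E} {ω : Finset E} (h : ↑ω ⊆ A) {N : ℕ}
    (hN : N ≤ ω.card) : minRieszEnergy s A N ≤ rieszEnergy s ω := by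
  obtain ⟨ω', hω', rfl⟩ := Finset.exists_subset_card_eq hN
  exact (minRieszEnergy_le ((Finset.coe_subset.2 hω').trans h)).trans (rieszEnergy_mono hω')

theorem minRieszEnergy_anti {A B : Set E} (h : A ⊆ B) (N : ℕ) :
    minRieszEnergy s B N ≤ minRieszEnergy s A N :=
  le_iInf fun ω => le_iInf fun hω => le_iInf fun hN => by
    subst hN; exact minRieszEnergy_le (hω.trans h)

/-- A similarity with ratio `c` multiplies the Riesz energy by `c ^ (-s)`. -/
theorem rieszEnergy_image {F : Type*} [PseudoEMetricSpace F] [DecidableEq F] {f : E → F}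
    (hf : Function.Injective f) {c : ℝ≥0∞} (hc0 : c ≠ 0) (hct : c ≠ ∞)
    (h : ∀ x y, edist (f x) (f y) = c * edist x y) (ω : Finset E) :
    rieszEnergy s (ω.image f) = c ^ (-s) * rieszEnergy s ω := by
  simp only [rieszEnergy_eq_sum_rieszKernel, Finset.mul_sum]
  rw [Finset.sum_image hf.injOn]
  refine Finset.sum_congr rfl fun x _ => ?_
  rw [Finset.sum_image hf.injOn]
  refine Finset.sum_congr rfl fun y _ => ?_
  unfold rieszKernel
  by_cases hxy : x = y
  · simp [hxy]
  · rw [if_neg hxy, if_neg (hf.ne hxy), h]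
    rcases eq_or_ne (edist x y) 0 with h0 | h0
    · rcases lt_trichotomy s 0 with hs | rfl | hs
      · rw [h0, mul_zero, ENNReal.zero_rpow_of_pos (by linarith), mul_zero]
      · simp
      · rw [h0, mul_zero, ENNReal.zero_rpow_of_neg (by linarith), ENNReal.mul_top]
        simp [ENNReal.rpow_eq_zero_iff, hc0, hct]
    · exact ENNReal.mul_rpow_of_ne_zero hc0 h0 _

theorem minRieszEnergy_image_le {F : Type*} [PseudoEMetricSpace F] {f : E → F}
    (hf : Function.Injective f) {c : ℝ≥0∞} (hc0 : c ≠ 0) (hct : c ≠ ∞)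
    (h : ∀ x y, edist (f x) (f y) = c * edist x y) {A : Set E} {B : Set F} (hAB : MapsTo f A B)
    (N : ℕ) : minRieszEnergy s B N ≤ c ^ (-s) * minRieszEnergy s A N := by
  have h1 : c ^ (-s) ≠ 0 := by simp [ENNReal.rpow_eq_zero_iff, hc0, hct]
  have h2 : c ^ (-s) ≠ ∞ := by simp [ENNReal.rpow_eq_top_iff, hc0, hct]
  rw [mul_comm, ← ENNReal.div_le_iff_le_mul (Or.inl h1) (Or.inl h2)]
  refine le_iInf fun ω => le_iInf fun hω => le_iInf fun hN => ?_
  rw [ENNReal.div_le_iff_le_mul (Or.inl h1) (Or.inl h2), mul_comm, ← rieszEnergy_image hf hc0 hct h,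
    ← hN, ← Finset.card_image_of_injective ω hf]
  refine minRieszEnergy_le ?_
  rw [Finset.coe_image]
  exact (hAB.mono_left hω).image_subset

/-- Discarding the interactions between different fibres of `φ` decreases the energy. -/
theorem sum_rieszEnergy_fiber_le {ι : Type*} [DecidableEq ι] (φ : E → ι) (K : Finset ι)
    (ω : Finset E) :
    ∑ k ∈ K, rieszEnergy s (ω.filter fun x => φ x = k) ≤ rieszEnergy s ω := by
  simp only [rieszEnergy_eq_sum_rieszKernel]
  calc ∑ k ∈ K, ∑ x ∈ ω with φ x = k, ∑ y ∈ ω with φ y = k, rieszKernel s x y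
      ≤ ∑ k ∈ K, ∑ x ∈ ω with φ x = k, ∑ y ∈ ω, rieszKernel s x y :=
        Finset.sum_le_sum fun k _ => Finset.sum_le_sum fun x _ =>
          Finset.sum_le_sum_of_subset (Finset.filter_subset _ _)
    _ = ∑ k ∈ K, ∑ x ∈ ω, if φ x = k then ∑ y ∈ ω, rieszKernel s x y else 0 := by
        simp only [Finset.sum_filter]
    _ = ∑ x ∈ ω, ∑ k ∈ K, if φ x = k then ∑ y ∈ ω, rieszKernel s x y else 0 := Finset.sum_comm
    _ ≤ ∑ x ∈ ω, ∑ y ∈ ω, rieszKernel s x y := by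
        refine Finset.sum_le_sum fun x _ => ?_
        rw [Finset.sum_ite_eq]
        split_ifs <;> simp

end Energy

section Cells

variable {d : ℕ}

/-- The index of the unit lattice cell containing `x`. -/
noncomputable def cellIndex (x : EuclideanSpace ℝ (Fin d)) : Fin d → ℤ := fun i => ⌊x i⌋

/-- An integer vector as a point of Euclidean space. -/
noncomputable def latticePoint (k : Fin d → ℤ) : EuclideanSpace ℝ (Fin d) :=
  WithLp.toLp 2 fun i => (k i : ℝ)

/-- The closed unit cube `[0,1]^d`. -/
def unitCube (d : ℕ) : Set (EuclideanSpace ℝ (Fin d)) := {x | ∀ i, x i ∈ Icc (0 : ℝ) 1}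

@[simp] theorem latticePoint_apply (k : Fin d → ℤ) (i : Fin d) : latticePoint k i = k i := rfl

theorem latticePoint_add (k l : Fin d → ℤ) :
    latticePoint (k + l) = latticePoint k + latticePoint l := by
  ext i; simp

@[simp] theorem latticePoint_zero : latticePoint (0 : Fin d → ℤ) = 0 := by
  ext i; simp

@[simp] theorem cellIndex_add_latticePoint (x : EuclideanSpace ℝ (Fin d)) (k : Fin d → ℤ) :
    cellIndex (x + latticePoint k) = cellIndex x + k := by
  ext i; simp [cellIndex]

theorem sub_latticePoint_mem_unitCube (x : EuclideanSpace ℝ (Fin d)) :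
    x - latticePoint (cellIndex x) ∈ unitCube d := by
  intro i
  simp only [PiLp.sub_apply, latticePoint_apply, cellIndex]
  exact ⟨by linarith [Int.floor_le (x i)], by linarith [Int.lt_floor_add_one (x i)]⟩

theorem measurable_cellIndex : Measurable (cellIndex : EuclideanSpace ℝ (Fin d) → Fin d → ℤ) := by
  unfold cellIndex
  refine measurable_pi_lambda _ fun i => Int.measurable_floor.comp ?_
  fun_prop

theorem volume_cellIndex_eq (k : Fin d → ℤ) :
    volume {x : EuclideanSpace ℝ (Fin d) | cellIndex x = k} = 1 := by
  have h : {x : EuclideanSpace ℝ (Fin d) | cellIndex x = k} =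
      (MeasurableEquiv.toLp 2 (Fin d → ℝ)).symm ⁻¹'
        (Set.pi univ fun i => Ico (k i : ℝ) (k i + 1)) := by
    ext x
    simp only [mem_ofPred_eq, mem_preimage, mem_univ_pi, cellIndex, funext_iff]
    exact forall_congr' fun i => Int.floor_eq_iff
  rw [h, (EuclideanSpace.volume_preserving_symm_measurableEquiv_toLp (Fin d)).measure_preimage_equiv,
    volume_pi_pi]
  simp

theorem dist_le_sqrt_of_abs_sub_le {x y : EuclideanSpace ℝ (Fin d)}
    (h : ∀ i, |x i - y i| ≤ 1) : dist x y ≤ √d := by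
  rw [EuclideanSpace.dist_eq]
  refine Real.sqrt_le_sqrt ?_
  calc ∑ i, dist (x i) (y i) ^ 2 ≤ ∑ _i : Fin d, (1 : ℝ) := by
        refine Finset.sum_le_sum fun i _ => ?_
        rw [Real.dist_eq]
        exact pow_le_one₀ (abs_nonneg _) (h i)
    _ = d := by simp

theorem dist_le_of_cellIndex_eq {x y : EuclideanSpace ℝ (Fin d)} (h : cellIndex x = cellIndex y) :
    dist x y ≤ √d :=
  dist_le_sqrt_of_abs_sub_le fun i => (Int.abs_sub_lt_one_of_floor_eq_floor (congrFun h i)).le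

/-- A set meets at most `volume V` cells if `V` contains its `√d`-neighbourhood. -/
theorem card_le_volume_of_cells {B V : Set (EuclideanSpace ℝ (Fin d))}
    (hV : ∀ b ∈ B, ∀ x, dist x b ≤ √d → x ∈ V) {K : Finset (Fin d → ℤ)}
    (hK : ↑K ⊆ cellIndex '' B) : (K.card : ℝ≥0∞) ≤ volume V := by
  have h : (⋃ k ∈ K, {x : EuclideanSpace ℝ (Fin d) | cellIndex x = k}) ⊆ V := by
    intro x hx
    simp only [mem_iUnion, mem_ofPred_eq, exists_prop, exists_eq_right'] at hx
    obtain ⟨b, hb, hbx⟩ := hK hx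
    exact hV b hb x (dist_le_of_cellIndex_eq hbx.symm)
  refine le_trans ?_ (measure_mono h)
  rw [measure_biUnion_finset]
  · simp [volume_cellIndex_eq]
  · intro k _ l _ hkl
    exact Set.disjoint_left.2 fun x hx hx' => hkl (hx.symm.trans hx')
  · exact fun k _ => measurable_cellIndex (measurableSet_singleton k)

theorem finite_image_cellIndex {B V : Set (EuclideanSpace ℝ (Fin d))}
    (hV : ∀ b ∈ B, ∀ x, dist x b ≤ √d → x ∈ V) (hfin : volume V ≠ ∞) :
    (cellIndex '' B).Finite := by
  by_contra hinf
  obtain ⟨n, hn⟩ := ENNReal.exists_nat_gt hfin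
  obtain ⟨K, hK, hcard⟩ := Set.Infinite.exists_subset_card_eq hinf n
  exact absurd (card_le_volume_of_cells hV hK) (by rw [hcard]; exact not_le.2 hn)

end Cells

section LowerBound

open scoped Pointwise

variable {d : ℕ} {s : ℝ}

theorem minRieszEnergy_smul_le {A : Set (EuclideanSpace ℝ (Fin d))} {r : ℝ} (hr : 0 < r) (N : ℕ) :
    minRieszEnergy s (r • A) N ≤ ENNReal.ofReal r ^ (-s) * minRieszEnergy s A N := by
  refine minRieszEnergy_image_le (f := fun x => r • x) (smul_right_injective _ hr.ne')
    (by simpa using hr) ENNReal.ofReal_ne_top (fun x y => ?_)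
    (fun x hx => Set.smul_mem_smul_set hx) N
  rw [edist_dist, edist_dist, dist_smul₀, Real.norm_of_nonneg hr.le, ENNReal.ofReal_mul hr.le]

theorem minRieszEnergy_le_smul {A : Set (EuclideanSpace ℝ (Fin d))} {r : ℝ} (hr : 0 < r) (N : ℕ) :
    minRieszEnergy s A N ≤ ENNReal.ofReal r ^ s * minRieszEnergy s (r • A) N := by
  have h := minRieszEnergy_smul_le (s := s) (A := r • A) (inv_pos.2 hr) N
  rwa [inv_smul_smul₀ hr.ne', ENNReal.ofReal_inv_of_pos hr, ENNReal.inv_rpow, ENNReal.rpow_neg,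
    inv_inv] at h

theorem minRieszEnergy_unitCube_le_of_cellIndex {ω : Finset (EuclideanSpace ℝ (Fin d))}
    {k : Fin d → ℤ} (h : ∀ x ∈ ω, cellIndex x = k) :
    minRieszEnergy s (unitCube d) ω.card ≤ rieszEnergy s ω := by
  have hmaps : MapsTo (fun x => x - latticePoint k) {x | cellIndex x = k} (unitCube d) := by
    rintro x rfl
    exact sub_latticePoint_mem_unitCube x
  have himage := minRieszEnergy_image_le (s := s) sub_left_injective one_ne_zero
    ENNReal.one_ne_top (fun x y => by simp) hmaps ω.card
  rw [ENNReal.one_rpow, one_mul] at himage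
  exact himage.trans (minRieszEnergy_le h)

theorem rpow_sum_natCast_le {ι : Type*} (K : Finset ι) (f : ι → ℕ) {p : ℝ} (hp : 1 ≤ p) :
    ((∑ k ∈ K, f k : ℕ) : ℝ≥0∞) ^ p ≤ (K.card : ℝ≥0∞) ^ (p - 1) * ∑ k ∈ K, (f k : ℝ≥0∞) ^ p := by
  have h := NNReal.rpow_sum_le_const_mul_sum_rpow K (fun k => (f k : ℝ≥0)) hp
  have hp0 : 0 ≤ p := by linarith
  have hp1 : 0 ≤ p - 1 := by linarith
  have h' := ENNReal.coe_le_coe.2 h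
  simpa [ENNReal.coe_rpow_of_nonneg _ hp0, ENNReal.coe_rpow_of_nonneg _ hp1] using h'

/-- A lower bound for the energies over the unit cube transfers to a set covered by finitely many
lattice cells. -/
theorem mul_rpow_le_of_cells {B : Set (EuclideanSpace ℝ (Fin d))} {K : Finset (Fin d → ℤ)}
    (hK : cellIndex '' B ⊆ ↑K) (hK0 : K.Nonempty) {a D : ℝ≥0∞} {p : ℝ} (hp : 1 ≤ p)
    (h : ∀ n : ℕ, a * (n : ℝ≥0∞) ^ p ≤ minRieszEnergy s (unitCube d) n + D) (N : ℕ) :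
    a * (N : ℝ≥0∞) ^ p ≤ (K.card : ℝ≥0∞) ^ (p - 1) * (minRieszEnergy s B N + K.card * D) := by
  have hp1 : 0 ≤ p - 1 := by linarith
  have hc0 : (K.card : ℝ≥0∞) ^ (p - 1) ≠ 0 := by
    simp [ENNReal.rpow_eq_zero_iff, hK0.ne_empty]
  have hct : (K.card : ℝ≥0∞) ^ (p - 1) ≠ ∞ :=
    ENNReal.rpow_ne_top_of_nonneg hp1 (ENNReal.natCast_ne_top _)
  rw [mul_comm (_ ^ (p - 1)), ← ENNReal.div_le_iff_le_mul (Or.inl hc0) (Or.inl hct),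
    ← tsub_le_iff_right]
  refine le_iInf fun ω => le_iInf fun hω => le_iInf fun hN => ?_
  rw [tsub_le_iff_right, ENNReal.div_le_iff_le_mul (Or.inl hc0) (Or.inl hct), mul_comm (_ + _)]
  have hcard : N = ∑ k ∈ K, (ω.filter fun x => cellIndex x = k).card := by
    rw [← hN]
    exact Finset.card_eq_sum_card_fiberwise fun x hx => hK (mem_image_of_mem _ (hω hx))
  calc a * (N : ℝ≥0∞) ^ p
      ≤ a * ((K.card : ℝ≥0∞) ^ (p - 1) *
          ∑ k ∈ K, (((ω.filter fun x => cellIndex x = k).card : ℕ) : ℝ≥0∞) ^ p) := by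
        nth_rewrite 1 [hcard]
        gcongr
        exact rpow_sum_natCast_le K _ hp
    _ = (K.card : ℝ≥0∞) ^ (p - 1) *
          ∑ k ∈ K, a * (((ω.filter fun x => cellIndex x = k).card : ℕ) : ℝ≥0∞) ^ p := by
        rw [mul_left_comm, Finset.mul_sum (a := a)]
    _ ≤ (K.card : ℝ≥0∞) ^ (p - 1) *
          ∑ k ∈ K, (rieszEnergy s (ω.filter fun x => cellIndex x = k) + D) := by
        gcongr with k hk
        refine (h _).trans ?_
        gcongr
        exact minRieszEnergy_unitCube_le_of_cellIndex fun x hx => (Finset.mem_filter.1 hx).2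
    _ ≤ (K.card : ℝ≥0∞) ^ (p - 1) * (rieszEnergy s ω + K.card * D) := by
        rw [Finset.sum_add_distrib, Finset.sum_const, nsmul_eq_mul]
        gcongr
        exact sum_rieszEnergy_fiber_le _ K ω

theorem mem_smul_cthickening_of_dist_le {A : Set (EuclideanSpace ℝ (Fin d))} {r δ : ℝ} (hr : 0 < r)
    {b x : EuclideanSpace ℝ (Fin d)} (hb : b ∈ r • A) (h : dist x b ≤ δ) :
    x ∈ r • cthickening (δ / r) A := by
  obtain ⟨y, hy, rfl⟩ := hb
  rw [Set.mem_smul_set_iff_inv_smul_mem₀ hr.ne']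
  refine mem_cthickening_of_dist_le _ y _ _ hy ?_
  rw [le_div_iff₀ hr]
  calc dist (r⁻¹ • x) y * r = r * dist (r⁻¹ • x) y := mul_comm _ _
    _ = dist (r • r⁻¹ • x) (r • y) := by rw [dist_smul₀, Real.norm_of_nonneg hr.le]
    _ ≤ δ := by rwa [smul_inv_smul₀ hr.ne']

theorem volume_smul_set {W : Set (EuclideanSpace ℝ (Fin d))} {r : ℝ} (hr : 0 < r) :
    volume (r • W) = ENNReal.ofReal r ^ d * volume W := by
  rw [Measure.addHaar_smul, abs_of_pos (pow_pos hr _), ENNReal.ofReal_pow hr.le]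
  simp

theorem volume_cthickening_ne_top {A : Set (EuclideanSpace ℝ (Fin d))} (hA : IsCompact A) (δ : ℝ) :
    volume (cthickening δ A) ≠ ∞ :=
  hA.isBounded.cthickening.measure_lt_top.ne

/-- Lower bound for the energies over `A`, from cells of side `r⁻¹`. -/
theorem mul_rpow_le_of_scale {A : Set (EuclideanSpace ℝ (Fin d))} (hA : IsCompact A)
    (hA0 : A.Nonempty) {r : ℝ} (hr : 0 < r) {a D : ℝ≥0∞} {p : ℝ} (hp : 1 ≤ p)
    (h : ∀ n : ℕ, a * (n : ℝ≥0∞) ^ p ≤ minRieszEnergy s (unitCube d) n + D) (N : ℕ) :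
    a * (N : ℝ≥0∞) ^ p ≤ (ENNReal.ofReal r ^ d * volume (cthickening (√d / r) A)) ^ (p - 1) *
      (ENNReal.ofReal r ^ (-s) * minRieszEnergy s A N +
        (ENNReal.ofReal r ^ d * volume (cthickening (√d / r) A)) * D) := by
  have hV : ∀ b ∈ r • A, ∀ x, dist x b ≤ √d → x ∈ r • cthickening (√d / r) A :=
    fun b hb x hx => mem_smul_cthickening_of_dist_le hr hb hx
  have hfin : volume (r • cthickening (√d / r) A) ≠ ∞ := by
    rw [volume_smul_set hr]
    exact ENNReal.mul_ne_top (by simp) (volume_cthickening_ne_top hA _)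
  have hK := finite_image_cellIndex hV hfin
  have hcard := card_le_volume_of_cells hV (K := hK.toFinset) hK.coe_toFinset.le
  rw [volume_smul_set hr] at hcard
  refine (mul_rpow_le_of_cells (K := hK.toFinset) hK.coe_toFinset.ge (by simpa using hA0) hp h
    N).trans ?_
  have hp1 : 0 ≤ p - 1 := by linarith
  gcongr
  exact minRieszEnergy_smul_le hr N

theorem le_mul_liminf_of_le_mul_add {ι : Type*} {l : Filter ι} [l.NeBot] {f g : ι → ℝ≥0∞}
    {x c : ℝ≥0∞} (hc : c ≠ ∞) (hg : Tendsto g l (𝓝 0)) (h : ∀ᶠ i in l, x ≤ c * f i + g i) :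
    x ≤ c * liminf f l := by
  rw [← ENNReal.liminf_const_mul_of_ne_top hc]
  have ht : Tendsto (fun i => x - g i) l (𝓝 x) := by
    simpa using ENNReal.Tendsto.sub (tendsto_const_nhds (x := x)) hg (Or.inr ENNReal.zero_ne_top)
  rw [← ht.liminf_eq]
  exact liminf_le_liminf (h.mono fun i hi => tsub_le_iff_right.2 hi)

end LowerBound

section Liminf

open scoped Pointwise

variable {d : ℕ} {s : ℝ}

/-- The minimal Riesz energy divided by its order of growth `N ^ (1 + s / d)`. -/
noncomputable def normalizedRieszEnergy (s : ℝ) (A : Set (EuclideanSpace ℝ (Fin d))) (N : ℕ) :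
    ℝ≥0∞ :=
  minRieszEnergy s A N / (N : ℝ≥0∞) ^ (1 + s / d)

theorem normalizedRieszEnergy_anti {A B : Set (EuclideanSpace ℝ (Fin d))} (h : A ⊆ B) (N : ℕ) :
    normalizedRieszEnergy s B N ≤ normalizedRieszEnergy s A N :=
  ENNReal.div_le_div_right (minRieszEnergy_anti h N) _

theorem natCast_rpow_ne_zero {N : ℕ} (hN : N ≠ 0) (p : ℝ) : (N : ℝ≥0∞) ^ p ≠ 0 := by
  simp [ENNReal.rpow_eq_zero_iff, hN]

theorem natCast_rpow_ne_top {N : ℕ} (hN : N ≠ 0) (p : ℝ) : (N : ℝ≥0∞) ^ p ≠ ∞ := by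
  simp [ENNReal.rpow_eq_top_iff, hN]

theorem tendsto_const_div_natCast_rpow {x : ℝ≥0∞} (hx : x ≠ ∞) {p : ℝ} (hp : 0 < p) :
    Tendsto (fun N : ℕ => x / (N : ℝ≥0∞) ^ p) atTop (𝓝 0) := by
  have h : Tendsto (fun N : ℕ => (N : ℝ≥0∞) ^ p) atTop (𝓝 ∞) := by
    have := ((ENNReal.continuous_rpow_const (y := p)).tendsto ∞).comp ENNReal.tendsto_nat_nhds_top
    rwa [ENNReal.top_rpow_of_pos hp] at this
  simpa using ENNReal.Tendsto.const_div h (Or.inr hx)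

theorem ofReal_pow_rpow_div (hd : d ≠ 0) (r : ℝ) :
    (ENNReal.ofReal r ^ d) ^ (s / d) = ENNReal.ofReal r ^ s := by
  have hd' : (d : ℝ) ≠ 0 := Nat.cast_ne_zero.2 hd
  rw [← ENNReal.rpow_natCast, ← ENNReal.rpow_mul]
  congr 1
  field_simp

theorem le_volume_cthickening_mul_liminf (hd : d ≠ 0) (hs : 0 < s)
    {A : Set (EuclideanSpace ℝ (Fin d))} (hA : IsCompact A) (hA0 : A.Nonempty) {a : ℝ≥0∞}
    (ha : a < liminf (normalizedRieszEnergy s (unitCube d)) atTop) {r : ℝ} (hr : 0 < r) :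
    a ≤ volume (cthickening (√d / r) A) ^ (s / d) *
      liminf (normalizedRieszEnergy s A) atTop := by
  have hσ : 0 ≤ s / d := by positivity
  have hp : 1 ≤ 1 + s / d := by linarith
  have hp0 : 0 < 1 + s / d := by linarith
  have hR0 : ENNReal.ofReal r ≠ 0 := by simpa using hr
  set V := volume (cthickening (√d / r) A) with hV
  have hVt : V ≠ ∞ := volume_cthickening_ne_top hA _
  have hWt : ENNReal.ofReal r ^ d * V ≠ ∞ := ENNReal.mul_ne_top (by simp) hVt
  obtain ⟨N₀, hN₀⟩ := eventually_atTop.1 (eventually_lt_of_lt_liminf ha)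
  set D : ℝ≥0∞ := a * (N₀ : ℝ≥0∞) ^ (1 + s / d) with hD
  have hDt : D ≠ ∞ :=
    ENNReal.mul_ne_top ha.ne_top (ENNReal.rpow_ne_top_of_nonneg hp0.le (by simp))
  have hcube : ∀ n : ℕ, a * (n : ℝ≥0∞) ^ (1 + s / d) ≤ minRieszEnergy s (unitCube d) n + D := by
    intro n
    rcases le_total N₀ n with hn | hn
    · rcases eq_or_ne n 0 with rfl | hn0
      · simp [hp0]
      refine le_add_right ?_
      have := (hN₀ n hn).le
      rwa [normalizedRieszEnergy, ENNReal.le_div_iff_mul_le (Or.inl (natCast_rpow_ne_zero hn0 _))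
        (Or.inl (natCast_rpow_ne_top hn0 _))] at this
    · refine le_add_left ?_
      rw [hD]
      gcongr
  refine le_mul_liminf_of_le_mul_add (ENNReal.rpow_ne_top_of_nonneg hσ hVt)
    (tendsto_const_div_natCast_rpow (p := 1 + s / d)
      (x := (ENNReal.ofReal r ^ d * V) ^ (s / d) * (ENNReal.ofReal r ^ d * V * D)) ?_ hp0) ?_
  · exact ENNReal.mul_ne_top (ENNReal.rpow_ne_top_of_nonneg hσ hWt) (ENNReal.mul_ne_top hWt hDt)
  · filter_upwards [eventually_ne_atTop 0] with N hN
    have h := mul_rpow_le_of_scale hA hA0 hr hp hcube N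
    rw [← ENNReal.le_div_iff_mul_le (Or.inl (natCast_rpow_ne_zero hN _))
      (Or.inl (natCast_rpow_ne_top hN _)), add_sub_cancel_left, mul_add, ENNReal.add_div] at h
    refine h.trans_eq ?_
    congr 1
    rw [ENNReal.mul_rpow_of_nonneg _ _ hσ, ofReal_pow_rpow_div hd r, normalizedRieszEnergy,
      ← mul_div_assoc]
    congr 1
    calc ENNReal.ofReal r ^ s * V ^ (s / d) * (ENNReal.ofReal r ^ (-s) * minRieszEnergy s A N)
        = (ENNReal.ofReal r ^ s * ENNReal.ofReal r ^ (-s)) * (V ^ (s / d) *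
            minRieszEnergy s A N) := by ring
      _ = _ := by
        rw [← ENNReal.rpow_add _ _ hR0 ENNReal.ofReal_ne_top, add_neg_cancel, ENNReal.rpow_zero,
          one_mul]

theorem tendsto_volume_cthickening_div_atTop {A : Set (EuclideanSpace ℝ (Fin d))}
    (hA : IsCompact A) (δ : ℝ) :
    Tendsto (fun r => volume (cthickening (δ / r) A)) atTop (𝓝 (volume A)) :=
  (tendsto_measure_cthickening_of_isCompact hA).comp (tendsto_id.const_div_atTop δ)

theorem liminf_unitCube_div_le_liminf (hd : d ≠ 0) (hs : 0 < s)
    {A : Set (EuclideanSpace ℝ (Fin d))} (hA : IsCompact A) :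
    liminf (normalizedRieszEnergy s (unitCube d)) atTop / volume A ^ (s / d) ≤
      liminf (normalizedRieszEnergy s A) atTop := by
  wlog hA0 : A.Nonempty generalizing A with hgen
  · have : Nonempty (Fin d) := ⟨⟨0, Nat.pos_of_ne_zero hd⟩⟩
    have hzero := hgen (isCompact_singleton (x := 0)) (singleton_nonempty _)
    rw [not_nonempty_iff_eq_empty.1 hA0, measure_empty]
    calc _ ≤ _ := by simpa using hzero
      _ ≤ _ := liminf_le_liminf (Eventually.of_forall fun N =>
        normalizedRieszEnergy_anti (empty_subset _) N)
  rcases eq_or_ne (liminf (normalizedRieszEnergy s A) atTop) ∞ with hL | hL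
  · simp [hL]
  refine ENNReal.div_le_of_le_mul' (le_of_forall_lt_imp_le_of_dense fun a ha => ?_)
  have ht := ENNReal.Tendsto.mul_const (b := liminf (normalizedRieszEnergy s A) atTop)
    (((ENNReal.continuous_rpow_const (y := s / d)).tendsto _).comp
      (tendsto_volume_cthickening_div_atTop hA √d)) (Or.inr hL)
  refine ge_of_tendsto ht ?_
  filter_upwards [eventually_gt_atTop 0] with r hr
  exact le_volume_cthickening_mul_liminf hd hs hA hA0 ha hr

theorem isCompact_unitCube : IsCompact (unitCube d) := by
  refine Metric.isCompact_of_isClosed_isBounded ?_ ?_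
  · simp only [unitCube, Set.ofPred_forall]
    exact isClosed_iInter fun i => isClosed_Icc.preimage (by fun_prop)
  · refine (Metric.isBounded_closedBall (x := 0) (r := √d)).subset fun x hx => ?_
    refine mem_closedBall.2 (dist_le_sqrt_of_abs_sub_le fun i => ?_)
    rw [PiLp.zero_apply, sub_zero, abs_of_nonneg (hx i).1]
    exact (hx i).2

theorem zero_mem_unitCube : (0 : EuclideanSpace ℝ (Fin d)) ∈ unitCube d := fun i => by simp

theorem volume_unitCube_ne_zero : volume (unitCube d) ≠ 0 := by
  refine fun h => one_ne_zero (α := ℝ≥0∞) ?_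
  rw [← volume_cellIndex_eq (0 : Fin d → ℤ)]
  refine measure_mono_null (fun x hx => ?_) h
  have := sub_latticePoint_mem_unitCube x
  rwa [mem_ofPred.1 hx, latticePoint_zero, sub_zero] at this

theorem edist_le_of_mem_unitCube {x y : EuclideanSpace ℝ (Fin d)} (hx : x ∈ unitCube d)
    (hy : y ∈ unitCube d) : edist x y ≤ ENNReal.ofReal √d := by
  rw [edist_dist]
  refine ENNReal.ofReal_le_ofReal (dist_le_sqrt_of_abs_sub_le fun i => ?_)
  rw [abs_le]
  constructor <;> linarith [(hx i).1, (hx i).2, (hy i).1, (hy i).2]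

theorem mul_natCast_le_minRieszEnergy_unitCube (hs : 0 < s) (n : ℕ) :
    ENNReal.ofReal √d ^ (-s) * (n : ℝ≥0∞) ^ (1 : ℝ) ≤
      minRieszEnergy s (unitCube d) n + ENNReal.ofReal √d ^ (-s) := by
  rw [ENNReal.rpow_one]
  set a := ENNReal.ofReal √d ^ (-s) with ha
  rw [← tsub_le_iff_right]
  refine le_iInf fun ω => le_iInf fun hω => le_iInf fun hN => ?_
  rw [tsub_le_iff_right]
  rcases Nat.lt_or_ge n 2 with hn | hn
  · refine le_add_left ?_
    have : (n : ℝ≥0∞) ≤ 1 := by exact_mod_cast Nat.lt_succ_iff.1 hn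
    calc a * n ≤ a * 1 := by gcongr
      _ = a := mul_one a
  refine le_add_right ?_
  rw [rieszEnergy_eq_sum_rieszKernel, mul_comm, ← hN, ← nsmul_eq_mul]
  refine Finset.card_nsmul_le_sum _ _ _ fun x hx => ?_
  obtain ⟨y, hy, hxy⟩ := Finset.exists_mem_ne (by omega : 1 < ω.card) x
  refine le_trans ?_ (Finset.single_le_sum (f := fun y => rieszKernel s x y)
    (fun _ _ => bot_le) hy)
  rw [rieszKernel, if_neg hxy.symm, ha, ENNReal.rpow_neg, ENNReal.rpow_neg]
  refine ENNReal.inv_le_inv.2 (ENNReal.rpow_le_rpow ?_ hs.le)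
  exact edist_le_of_mem_unitCube (hω hx) (hω hy)

theorem liminf_unitCube_ne_zero (hd : d ≠ 0) (hs : 0 < s) :
    liminf (normalizedRieszEnergy s (unitCube d)) atTop ≠ 0 := by
  have hd0 : (0 : ℝ) < d := by positivity
  set a := ENNReal.ofReal √d ^ (-s) with ha
  have ha0 : a ≠ 0 := by simp [ha, ENNReal.rpow_eq_zero_iff, hd0]
  have hat : a ≠ ∞ := by simp [ha, ENNReal.rpow_eq_top_iff, hd0]
  set V := volume (cthickening √d (unitCube d)) with hV
  have hVt : V ≠ ∞ := volume_cthickening_ne_top isCompact_unitCube _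
  set W : ℝ := V.toReal + 1 with hW
  have hW0 : 0 < W := by positivity
  have hVW : V ≤ ENNReal.ofReal W := by
    rw [← ENNReal.ofReal_toReal hVt]
    exact ENNReal.ofReal_le_ofReal (by linarith)
  have key : ∀ᶠ N : ℕ in atTop, a / 2 * ENNReal.ofReal (1 / (2 * W)) ^ (s / d) ≤
      normalizedRieszEnergy s (unitCube d) N := by
    filter_upwards [eventually_ne_atTop 0,
      tendsto_natCast_atTop_atTop.eventually_ge_atTop (2 * W)] with N hN hNW
    have hN0 : (0 : ℝ) < N := by positivity
    set r : ℝ := ((N : ℝ) / (2 * W)) ^ (1 / (d : ℝ)) with hr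
    have hr1 : 1 ≤ r := Real.one_le_rpow ((one_le_div (by positivity)).2 hNW) (by positivity)
    have hr0 : 0 < r := by linarith
    have hrd : ENNReal.ofReal r ^ d = ENNReal.ofReal (N / (2 * W)) := by
      rw [← ENNReal.ofReal_pow hr0.le, hr, ← Real.rpow_natCast, ← Real.rpow_mul (by positivity),
        one_div_mul_cancel hd0.ne', Real.rpow_one]
    have hmul : ENNReal.ofReal r ^ d * volume (cthickening (√d / r) (unitCube d)) * a ≤
        a * N / 2 := by
      calc ENNReal.ofReal r ^ d * volume (cthickening (√d / r) (unitCube d)) * a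
          ≤ ENNReal.ofReal r ^ d * ENNReal.ofReal W * a := by
            gcongr
            exact (measure_mono (cthickening_mono (div_le_self (by positivity) hr1) _)).trans hVW
        _ = a * N / 2 := by
            rw [hrd, ← ENNReal.ofReal_mul (by positivity),
              show (N : ℝ) / (2 * W) * W = N / 2 by field_simp,
              ENNReal.ofReal_div_of_pos (by norm_num), ENNReal.ofReal_natCast, mul_comm,
              mul_div_assoc]
            simp
    have h := mul_rpow_le_of_scale (isCompact_unitCube (d := d)) ⟨0, zero_mem_unitCube⟩ hr0 le_rfl
      (mul_natCast_le_minRieszEnergy_unitCube hs) N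
    rw [sub_self, ENNReal.rpow_zero, one_mul, ENNReal.rpow_one] at h
    have h2 : a * N / 2 ≤ ENNReal.ofReal r ^ (-s) * minRieszEnergy s (unitCube d) N := by
      refine ENNReal.le_of_add_le_add_right ?_ ((ENNReal.add_halves _).le.trans
        (h.trans (add_le_add_right hmul _)))
      exact ENNReal.div_ne_top (ENNReal.mul_ne_top hat (ENNReal.natCast_ne_top N)) (by simp)
    have hR0 : ENNReal.ofReal r ≠ 0 := by simpa using hr0
    rw [normalizedRieszEnergy, ENNReal.le_div_iff_mul_le (Or.inl (natCast_rpow_ne_zero hN _))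
        (Or.inl (natCast_rpow_ne_top hN _))]
    calc a / 2 * ENNReal.ofReal (1 / (2 * W)) ^ (s / d) * (N : ℝ≥0∞) ^ (1 + s / d)
        = (ENNReal.ofReal (1 / (2 * W)) * N) ^ (s / d) * (a * N / 2) := by
          rw [ENNReal.rpow_add _ _ (by simpa using hN) (by simp), ENNReal.rpow_one,
            ENNReal.mul_rpow_of_nonneg _ _ (by positivity), ENNReal.mul_div_right_comm]
          ring
      _ = ENNReal.ofReal r ^ s * (a * N / 2) := by
          rw [← ofReal_pow_rpow_div hd r, hrd, ← ENNReal.ofReal_natCast N,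
            ← ENNReal.ofReal_mul (by positivity)]
          congr 3
          ring
      _ ≤ ENNReal.ofReal r ^ s * (ENNReal.ofReal r ^ (-s) * minRieszEnergy s (unitCube d) N) := by
          gcongr
      _ = minRieszEnergy s (unitCube d) N := by
          rw [← mul_assoc, ← ENNReal.rpow_add _ _ hR0 ENNReal.ofReal_ne_top, add_neg_cancel,
            ENNReal.rpow_zero, one_mul]
  refine ne_of_gt (lt_of_lt_of_le (pos_iff_ne_zero.2 ?_) (le_liminf_of_le (by isBoundedDefault) key))
  refine mul_ne_zero (ENNReal.div_ne_zero.2 ⟨ha0, by simp⟩) ?_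
  simp only [ne_eq, ENNReal.rpow_eq_zero_iff, ENNReal.ofReal_eq_zero, ENNReal.ofReal_ne_top,
    false_and, or_false, not_and, not_lt]
  intro h
  have : 0 < 1 / (2 * W) := by positivity
  linarith

end Liminf

section UpperBound

open scoped Pointwise

variable {d : ℕ} {s : ℝ}

/-- The Riesz energy per period of the `ℤ^d`-periodic extension of a configuration. -/
noncomputable def periodicEnergy (s : ℝ) (ω : Finset (EuclideanSpace ℝ (Fin d))) : ℝ≥0∞ :=
  ∑ x ∈ ω, ∑ y ∈ ω, ∑' l : Fin d → ℤ, rieszKernel s x (y + latticePoint l)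

theorem tsum_volume_inter_cellIndex {B : Set (EuclideanSpace ℝ (Fin d))} (hB : MeasurableSet B) :
    ∑' k, volume (B ∩ {x | cellIndex x = k}) = volume B := by
  have hU : ⋃ k, B ∩ {x | cellIndex x = k} = B := by
    ext x; simp
  conv_rhs => rw [← hU]
  refine (measure_iUnion (fun k l hkl => ?_) fun k =>
    hB.inter (measurable_cellIndex (measurableSet_singleton k))).symm
  exact Set.disjoint_left.2 fun x hx hx' => hkl (hx.2.symm.trans hx'.2)

/-- Averaging over translates: some translate of a periodic configuration has at least the expected
number of points in `B`. -/
theorem exists_mul_volume_le_sum_indicator (ω : Finset (EuclideanSpace ℝ (Fin d)))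
    {B : Set (EuclideanSpace ℝ (Fin d))} (hB : MeasurableSet B) (hfin : volume B ≠ ∞) :
    ∃ t, (ω.card : ℝ≥0∞) * volume B ≤
      ∑ x ∈ ω, ∑' k, B.indicator (fun _ => (1 : ℝ≥0∞)) (x + latticePoint k + t) := by
  set F : Set (EuclideanSpace ℝ (Fin d)) := {x | cellIndex x = 0} with hF
  have : IsProbabilityMeasure (volume.restrict F) :=
    ⟨by rw [Measure.restrict_apply_univ, volume_cellIndex_eq]⟩
  have hmeas : ∀ x : EuclideanSpace ℝ (Fin d),
      Measurable fun t => B.indicator (fun _ => (1 : ℝ≥0∞)) (x + t) :=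
    fun x => (measurable_const.indicator hB).comp (measurable_const_add x)
  have hint : ∫⁻ t in F, ∑ x ∈ ω, ∑' k, B.indicator (fun _ => (1 : ℝ≥0∞)) (x + latticePoint k + t) =
      ω.card * volume B := by
    rw [lintegral_finsetSum _ fun x _ => Measurable.tsum fun k => hmeas _,
      ← nsmul_eq_mul, ← Finset.sum_const]
    refine Finset.sum_congr rfl fun x _ => ?_
    rw [lintegral_tsum fun k => (hmeas _).aemeasurable, ← measure_preimage_add volume x B,
      ← tsum_volume_inter_cellIndex (measurable_const_add x hB)]
    refine tsum_congr fun k => ?_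
    have hset : ((fun t => x + latticePoint k + t) ⁻¹' B) ∩ F =
        (fun t => t + latticePoint k) ⁻¹' (((fun t => x + t) ⁻¹' B) ∩ {y | cellIndex y = k}) := by
      ext t
      simp [hF, add_comm, add_left_comm]
    rw [← measure_preimage_add_right volume (latticePoint k), ← hset,
      ← Measure.restrict_apply (measurable_const_add _ hB),
      ← lintegral_indicator_one (measurable_const_add _ hB)]
    rfl
  obtain ⟨t, ht⟩ := exists_lintegral_le (μ := volume.restrict F)
    (hint ▸ ENNReal.mul_ne_top (by simp) hfin)
  exact ⟨t, hint ▸ ht⟩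

theorem rieszKernel_add_latticePoint (x y : EuclideanSpace ℝ (Fin d)) (k l : Fin d → ℤ) :
    rieszKernel s (x + latticePoint k) (y + latticePoint l) =
      rieszKernel s x (y + latticePoint (l - k)) := by
  have h : y + latticePoint l = y + latticePoint (l - k) + latticePoint k := by
    rw [add_assoc, ← latticePoint_add, sub_add_cancel]
  rw [h]
  simp [rieszKernel]

theorem sum_rieszKernel_add_latticePoint_le (ω : Finset (EuclideanSpace ℝ (Fin d)))
    (K : Finset (Fin d → ℤ)) :
    ∑ z ∈ ω ×ˢ K, ∑ z' ∈ ω ×ˢ K,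
      rieszKernel s (z.1 + latticePoint z.2) (z'.1 + latticePoint z'.2) ≤
        K.card * periodicEnergy s ω := by
  have h : ∀ x y : EuclideanSpace ℝ (Fin d), ∀ k : Fin d → ℤ,
      ∑ l ∈ K, rieszKernel s (x + latticePoint k) (y + latticePoint l) ≤
        ∑' l : Fin d → ℤ, rieszKernel s x (y + latticePoint l) := by
    intro x y k
    simp only [rieszKernel_add_latticePoint]
    refine (ENNReal.sum_le_tsum K).trans_eq ?_
    exact (Equiv.subRight k).tsum_eq fun l => rieszKernel s x (y + latticePoint l)
  simp only [Finset.sum_product, periodicEnergy]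
  rw [← nsmul_eq_mul, Finset.smul_sum]
  refine Finset.sum_le_sum fun x _ => ?_
  refine Finset.sum_le_card_nsmul _ _ _ fun k _ => ?_
  exact Finset.sum_le_sum fun y _ => h x y k

theorem minRieszEnergy_le_volume_mul_of_sum_indicator {B V : Set (EuclideanSpace ℝ (Fin d))}
    (hV : ∀ b ∈ B, ∀ x, dist x b ≤ √d → x ∈ V) (hfin : volume V ≠ ∞)
    {ω : Finset (EuclideanSpace ℝ (Fin d))} (hω : ∀ x ∈ ω, cellIndex x = 0) {N : ℕ}
    (hN : (N : ℝ≥0∞) ≤ ∑ x ∈ ω, ∑' k, B.indicator (fun _ => (1 : ℝ≥0∞)) (x + latticePoint k)) :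
    minRieszEnergy s B N ≤ volume V * periodicEnergy s ω := by
  have hK := finite_image_cellIndex hV hfin
  set K := hK.toFinset with hKdef
  have hcard : (K.card : ℝ≥0∞) ≤ volume V := card_le_volume_of_cells hV hK.coe_toFinset.le
  set f : EuclideanSpace ℝ (Fin d) × (Fin d → ℤ) → EuclideanSpace ℝ (Fin d) :=
    fun z => z.1 + latticePoint z.2 with hf
  set T := (ω ×ˢ K).filter fun z => f z ∈ B with hT
  have hTsub : T ⊆ ω ×ˢ K := Finset.filter_subset _ _
  have hinj : Set.InjOn f T := by
    rintro ⟨x, k⟩ hx ⟨y, l⟩ hy hxy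
    have hx' := hω x (Finset.mem_product.1 (hTsub hx)).1
    have hy' := hω y (Finset.mem_product.1 (hTsub hy)).1
    have hkl : k = l := by
      have := congrArg cellIndex hxy
      simpa [hf, hx', hy'] using this
    subst hkl
    simpa [hf] using hxy
  have hcardT : N ≤ (T.image f).card := by
    rw [Finset.card_image_of_injOn hinj]
    refine Nat.cast_le (α := ℝ≥0∞).1 (hN.trans_eq ?_)
    rw [hT, Finset.card_filter, Finset.sum_product, Nat.cast_sum]
    refine Finset.sum_congr rfl fun x hx => ?_
    rw [tsum_eq_sum (s := K), Nat.cast_sum]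
    · refine Finset.sum_congr rfl fun k _ => ?_
      simp [Set.indicator_apply, hf]
    · intro k hk
      refine Set.indicator_of_notMem (fun hmem => hk ?_) _
      rw [hKdef, Set.Finite.mem_toFinset]
      exact ⟨_, hmem, by simp [hω x hx]⟩
  have hsub : ↑(T.image f) ⊆ B := by
    intro y hy
    obtain ⟨z, hz, rfl⟩ := Finset.mem_image.1 (Finset.mem_coe.1 hy)
    exact (Finset.mem_filter.1 hz).2
  refine (minRieszEnergy_le_of_le_card hsub hcardT).trans ?_
  rw [rieszEnergy_eq_sum_rieszKernel, Finset.sum_image hinj]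
  calc ∑ z ∈ T, ∑ y ∈ T.image f, rieszKernel s (f z) y
      = ∑ z ∈ T, ∑ z' ∈ T, rieszKernel s (f z) (f z') :=
        Finset.sum_congr rfl fun z _ => Finset.sum_image hinj
    _ ≤ ∑ z ∈ ω ×ˢ K, ∑ z' ∈ ω ×ˢ K, rieszKernel s (f z) (f z') :=
        (Finset.sum_le_sum fun z _ => Finset.sum_le_sum_of_subset hTsub).trans
          (Finset.sum_le_sum_of_subset hTsub)
    _ ≤ K.card * periodicEnergy s ω := sum_rieszKernel_add_latticePoint_le ω K
    _ ≤ volume V * periodicEnergy s ω := by gcongr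

theorem minRieszEnergy_le_volume_mul_periodicEnergy {B V : Set (EuclideanSpace ℝ (Fin d))}
    (hB : MeasurableSet B) (hV : ∀ b ∈ B, ∀ x, dist x b ≤ √d → x ∈ V) (hfin : volume V ≠ ∞)
    {ω : Finset (EuclideanSpace ℝ (Fin d))} (hω : ∀ x ∈ ω, cellIndex x = 0) {N : ℕ}
    (hN : (N : ℝ≥0∞) ≤ ω.card * volume B) :
    minRieszEnergy s B N ≤ volume V * periodicEnergy s ω := by
  have hBV : B ⊆ V := fun b hb => hV b hb b (by simp)
  obtain ⟨t, ht⟩ := exists_mul_volume_le_sum_indicator ω hB (measure_ne_top_of_subset hBV hfin)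
  have hmaps : MapsTo (fun x => x + t) ((fun x => x + t) ⁻¹' B) B := fun x hx => hx
  have himage := minRieszEnergy_image_le (s := s) (add_left_injective t) one_ne_zero
    ENNReal.one_ne_top (fun x y => by simp) hmaps N
  rw [ENNReal.one_rpow, one_mul] at himage
  rw [← measure_preimage_add_right volume t V] at hfin ⊢
  refine himage.trans (minRieszEnergy_le_volume_mul_of_sum_indicator (fun b hb x hx => ?_) hfin hω
    (hN.trans ht))
  exact hV _ hb _ (by simpa using hx)

theorem minRieszEnergy_le_of_scale {A : Set (EuclideanSpace ℝ (Fin d))} (hA : IsCompact A) {r : ℝ}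
    (hr : 0 < r) {ω : Finset (EuclideanSpace ℝ (Fin d))} (hω : ∀ x ∈ ω, cellIndex x = 0) {N : ℕ}
    (hN : (N : ℝ≥0∞) ≤ ω.card * (ENNReal.ofReal r ^ d * volume A)) :
    minRieszEnergy s A N ≤ ENNReal.ofReal r ^ s *
      (ENNReal.ofReal r ^ d * volume (cthickening (√d / r) A) * periodicEnergy s ω) := by
  have hfin : volume (r • cthickening (√d / r) A) ≠ ∞ := by
    rw [volume_smul_set hr]
    exact ENNReal.mul_ne_top (by simp) (volume_cthickening_ne_top hA _)
  have h := minRieszEnergy_le_volume_mul_periodicEnergy (s := s) (B := r • A)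
    (hA.smul r).isClosed.measurableSet
    (fun b hb x hx => mem_smul_cthickening_of_dist_le hr hb hx) hfin hω (N := N)
    (by rwa [volume_smul_set hr])
  rw [volume_smul_set hr] at h
  refine (minRieszEnergy_le_smul hr N).trans ?_
  gcongr

theorem limsup_mul_volume_rpow_le (hd : d ≠ 0) (hs : 0 < s)
    {A : Set (EuclideanSpace ℝ (Fin d))} (hA : IsCompact A)
    {ω : Finset (EuclideanSpace ℝ (Fin d))} (hω : ∀ x ∈ ω, cellIndex x = 0) (hω0 : ω.Nonempty) :
    limsup (normalizedRieszEnergy s A) atTop * volume A ^ (s / d) ≤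
      periodicEnergy s ω / (ω.card : ℝ≥0∞) ^ (1 + s / d) := by
  have hσ : 0 < s / d := by positivity
  have hd0 : (0 : ℝ) < d := by positivity
  have hp0 : 0 < 1 + s / d := by linarith
  have hn : ω.card ≠ 0 := hω0.card_ne_zero
  rcases eq_or_ne (volume A) 0 with hA0 | hA0
  · simp [hA0, hσ]
  have hAt : volume A ≠ ∞ := hA.measure_lt_top.ne
  set e := periodicEnergy s ω with he
  rcases eq_or_ne e ∞ with het | het
  · rw [het, ENNReal.top_div_of_ne_top (natCast_rpow_ne_top hn _)]
    exact le_top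
  have ha : 0 < (volume A).toReal := ENNReal.toReal_pos hA0 hAt
  set M : ℝ := ω.card * (volume A).toReal with hM
  have hM0 : 0 < M := by positivity
  have hMeq : ENNReal.ofReal M = ω.card * volume A := by
    rw [hM, ENNReal.ofReal_mul (by positivity), ENNReal.ofReal_natCast, ENNReal.ofReal_toReal hAt]
  have hMp0 : ENNReal.ofReal M ^ (1 + s / d) ≠ 0 := by
    simp [ENNReal.rpow_eq_zero_iff, hM0]
  set r : ℕ → ℝ := fun N => ((N : ℝ) / M) ^ (1 / (d : ℝ)) with hr
  have hrtop : Tendsto r atTop atTop :=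
    (tendsto_rpow_atTop (by positivity)).comp
      (tendsto_natCast_atTop_atTop.atTop_div_const hM0)
  have hbound : ∀ᶠ N in atTop, normalizedRieszEnergy s A N ≤
      volume (cthickening (√d / r N) A) * (e / ENNReal.ofReal M ^ (1 + s / d)) := by
    filter_upwards [eventually_ne_atTop 0] with N hN
    have hN0 : (0 : ℝ) < N := by positivity
    have hr0 : 0 < r N := Real.rpow_pos_of_pos (by positivity) _
    have hrd : ENNReal.ofReal (r N) ^ d = N / ENNReal.ofReal M := by
      rw [← ENNReal.ofReal_pow hr0.le, hr, ← Real.rpow_natCast, ← Real.rpow_mul (by positivity),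
        one_div_mul_cancel hd0.ne', Real.rpow_one, ENNReal.ofReal_div_of_pos hM0,
        ENNReal.ofReal_natCast]
    have hNle : (N : ℝ≥0∞) ≤ ω.card * (ENNReal.ofReal (r N) ^ d * volume A) := by
      rw [mul_left_comm, ← hMeq, hrd, ENNReal.div_mul_cancel (by simpa using hM0)
        ENNReal.ofReal_ne_top]
    have h := minRieszEnergy_le_of_scale (s := s) hA hr0 hω hNle
    rw [normalizedRieszEnergy, ENNReal.div_le_iff (natCast_rpow_ne_zero hN _)
      (natCast_rpow_ne_top hN _)]
    refine h.trans_eq ?_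
    have hpow : ENNReal.ofReal (r N) ^ s * ENNReal.ofReal (r N) ^ d =
        (N : ℝ≥0∞) ^ (1 + s / d) / ENNReal.ofReal M ^ (1 + s / d) := by
      rw [← ENNReal.div_rpow_of_nonneg _ _ hp0.le, ← hrd, ← ofReal_pow_rpow_div hd,
        add_comm, ENNReal.rpow_add _ _ (by simp [hr0]) (by simp), ENNReal.rpow_one]
    rw [← mul_assoc, ← mul_assoc, hpow, ← he, div_eq_mul_inv, div_eq_mul_inv e]
    ring
  have hlim : Tendsto (fun N => volume (cthickening (√d / r N) A) *
      (e / ENNReal.ofReal M ^ (1 + s / d))) atTop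
      (𝓝 (volume A * (e / ENNReal.ofReal M ^ (1 + s / d)))) :=
    ENNReal.Tendsto.mul_const ((tendsto_volume_cthickening_div_atTop hA √d).comp hrtop)
      (Or.inr (ENNReal.div_ne_top het hMp0))
  have hlimsup := (limsup_le_limsup hbound).trans_eq hlim.limsup_eq
  calc limsup (normalizedRieszEnergy s A) atTop * volume A ^ (s / d)
      ≤ volume A * (e / ENNReal.ofReal M ^ (1 + s / d)) * volume A ^ (s / d) := by gcongr
    _ = e * volume A ^ (1 + s / d) / ENNReal.ofReal M ^ (1 + s / d) := by
        rw [ENNReal.rpow_add _ _ hA0 hAt, ENNReal.rpow_one, div_eq_mul_inv e, div_eq_mul_inv (e * _)]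
        ring
    _ = e / (ω.card : ℝ≥0∞) ^ (1 + s / d) := by
        rw [hMeq, ENNReal.mul_rpow_of_nonneg _ _ hp0.le, ENNReal.mul_div_mul_right]
        · simp [ENNReal.rpow_eq_zero_iff, hA0, hAt]
        · exact ENNReal.rpow_ne_top_of_nonneg hp0.le hAt

end UpperBound

section Limit

variable {d : ℕ} {s : ℝ}

/-- The lattice sum `∑ ‖l‖ ^ (-s)` over the nonzero integer vectors, in the sup norm. -/
noncomputable def latticeZeta (d : ℕ) (s : ℝ) : ℝ≥0∞ :=
  ∑' l : Fin d → ℤ, if l = 0 then 0 else ENNReal.ofReal ‖l‖ ^ (-s)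

theorem latticeZeta_ne_top (hs : (d : ℝ) < s) : latticeZeta d s ≠ ∞ := by
  let b := Pi.basisFun ℝ (Fin d)
  let L := Submodule.span ℤ (Set.range b)
  have hrank : Module.finrank ℤ L = d := by
    rw [ZLattice.rank ℝ]
    simp
  have hsum := ZLattice.summable_norm_rpow L (-s) (by rw [hrank]; linarith)
  let φ : (Fin d → ℤ) → L := fun l => ∑ i, l i • (⟨b i, Submodule.subset_span ⟨i, rfl⟩⟩ : L)
  have hφ : ∀ l : Fin d → ℤ, ((φ l : L) : Fin d → ℝ) = fun i => (l i : ℝ) := by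
    intro l
    ext i
    simp [φ, b, Finset.sum_apply, Pi.single_apply]
  have hinj : Function.Injective φ := by
    intro l m hlm
    have := (hφ l).symm.trans ((congrArg Subtype.val hlm).trans (hφ m))
    ext i
    exact_mod_cast congrFun this i
  have hnorm : ∀ l, ‖φ l‖ = ‖l‖ := by
    intro l
    rw [Submodule.coe_norm, hφ]
    simp only [Pi.norm_def, NNReal.coe_inj]
    exact Finset.sup_congr rfl fun i _ => NNReal.eq (Int.norm_cast_real _)
  have hsum' : Summable fun l : Fin d → ℤ => ‖l‖ ^ (-s) := by
    refine (hsum.comp_injective hinj).congr fun l => ?_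
    rw [Function.comp_apply, hnorm]
  refine ne_top_of_le_ne_top hsum'.tsum_ofReal_ne_top (ENNReal.tsum_le_tsum fun l => ?_)
  split_ifs with hl
  · exact bot_le
  · rw [ENNReal.ofReal_rpow_of_pos (norm_pos_iff.2 hl)]

theorem norm_mul_le_dist_add_latticePoint {γ : ℝ} (hγ0 : 0 < γ) (hγ1 : γ ≤ 1)
    {x y : EuclideanSpace ℝ (Fin d)} (h : ∀ i, |x i - y i| ≤ 1 - γ) (l : Fin d → ℤ) :
    γ * ‖l‖ ≤ dist x (y + latticePoint l) := by
  rw [mul_comm, ← le_div_iff₀ hγ0, pi_norm_le_iff_of_nonneg (by positivity)]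
  intro i
  rw [le_div_iff₀ hγ0, Int.norm_eq_abs]
  have hdist : |x i - y i - l i| ≤ dist x (y + latticePoint l) := by
    have := PiLp.norm_apply_le (x - (y + latticePoint l)) i
    rw [← dist_eq_norm, Real.norm_eq_abs] at this
    simpa [sub_sub] using this
  refine le_trans ?_ hdist
  rcases eq_or_ne (l i) 0 with hl | hl
  · simp [hl]
  have h1 : (1 : ℝ) ≤ |(l i : ℝ)| := by exact_mod_cast Int.one_le_abs hl
  have h2 : |(l i : ℝ)| ≤ |x i - y i| + |x i - y i - l i| := by
    have := abs_sub (x i - y i) (x i - y i - l i)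
    simpa using this
  nlinarith [h i]

theorem tsum_rieszKernel_smul_le (hs : 0 < s) {γ : ℝ} (hγ0 : 0 < γ) (hγ1 : γ < 1)
    {x y : EuclideanSpace ℝ (Fin d)} (hx : x ∈ unitCube d) (hy : y ∈ unitCube d) :
    ∑' l : Fin d → ℤ, rieszKernel s ((1 - γ) • x) ((1 - γ) • y + latticePoint l) ≤
      rieszKernel s ((1 - γ) • x) ((1 - γ) • y) + ENNReal.ofReal γ ^ (-s) * latticeZeta d s := by
  have hδ : 0 < 1 - γ := by linarith
  have hcoord : ∀ i, |((1 - γ) • x) i - ((1 - γ) • y) i| ≤ 1 - γ := by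
    intro i
    rw [PiLp.smul_apply, PiLp.smul_apply, smul_eq_mul, smul_eq_mul, ← mul_sub, abs_mul,
      abs_of_pos hδ]
    refine mul_le_of_le_one_right hδ.le (abs_le.2 ?_)
    constructor <;> linarith [(hx i).1, (hx i).2, (hy i).1, (hy i).2]
  rw [ENNReal.tsum_eq_add_tsum_ite (0 : Fin d → ℤ), latticePoint_zero, add_zero, latticeZeta,
    ← ENNReal.tsum_mul_left]
  refine add_le_add_right (ENNReal.tsum_le_tsum fun l => ?_) _
  split_ifs with hl
  · exact bot_le
  rw [← ENNReal.mul_rpow_of_ne_top ENNReal.ofReal_ne_top ENNReal.ofReal_ne_top,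
    ← ENNReal.ofReal_mul hγ0.le, rieszKernel]
  split_ifs with hxy
  · exact bot_le
  rw [ENNReal.rpow_neg, ENNReal.rpow_neg, edist_dist]
  exact ENNReal.inv_le_inv.2 (ENNReal.rpow_le_rpow
    (ENNReal.ofReal_le_ofReal (norm_mul_le_dist_add_latticePoint hγ0 hγ1.le hcoord l)) hs.le)

/-- The energy of a cube configuration shrunk towards the origin and repeated periodically. -/
theorem periodicEnergy_image_smul_le (hs : 0 < s) {γ : ℝ} (hγ0 : 0 < γ) (hγ1 : γ < 1)
    {ω : Finset (EuclideanSpace ℝ (Fin d))} (hω : ↑ω ⊆ unitCube d) :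
    periodicEnergy s (ω.image fun x => (1 - γ) • x) ≤
      ENNReal.ofReal (1 - γ) ^ (-s) * rieszEnergy s ω +
        (ω.card : ℝ≥0∞) ^ 2 * (ENNReal.ofReal γ ^ (-s) * latticeZeta d s) := by
  have hδ : 0 < 1 - γ := by linarith
  have hinj : Function.Injective fun x : EuclideanSpace ℝ (Fin d) => (1 - γ) • x :=
    smul_right_injective _ hδ.ne'
  have hscale : rieszEnergy s (ω.image fun x => (1 - γ) • x) =
      ENNReal.ofReal (1 - γ) ^ (-s) * rieszEnergy s ω :=
    rieszEnergy_image hinj (by simpa using hγ1) ENNReal.ofReal_ne_top (fun x y => by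
      rw [edist_dist, edist_dist, dist_smul₀, Real.norm_of_nonneg hδ.le,
        ENNReal.ofReal_mul hδ.le]) ω
  rw [← hscale, periodicEnergy, rieszEnergy_eq_sum_rieszKernel]
  simp only [Finset.sum_image hinj.injOn]
  calc _ ≤ ∑ x ∈ ω, ∑ y ∈ ω, (rieszKernel s ((1 - γ) • x) ((1 - γ) • y) +
          ENNReal.ofReal γ ^ (-s) * latticeZeta d s) :=
        Finset.sum_le_sum fun x hx => Finset.sum_le_sum fun y hy =>
          tsum_rieszKernel_smul_le hs hγ0 hγ1 (hω hx) (hω hy)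
    _ = _ := by
        simp only [Finset.sum_add_distrib, Finset.sum_const, nsmul_eq_mul]
        ring

theorem limsup_mul_volume_rpow_le_add (hd : d ≠ 0) (hs : 0 < s)
    {A : Set (EuclideanSpace ℝ (Fin d))} (hA : IsCompact A) {γ : ℝ} (hγ0 : 0 < γ) (hγ1 : γ < 1)
    {n : ℕ} (hn : n ≠ 0) :
    limsup (normalizedRieszEnergy s A) atTop * volume A ^ (s / d) ≤
      ENNReal.ofReal (1 - γ) ^ (-s) * normalizedRieszEnergy s (unitCube d) n +
        ENNReal.ofReal γ ^ (-s) * latticeZeta d s / (n : ℝ≥0∞) ^ (s / d - 1) := by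
  have hδ : 0 < 1 - γ := by linarith
  have hc0 : ENNReal.ofReal (1 - γ) ^ (-s) ≠ 0 := by simp [ENNReal.rpow_eq_zero_iff, hγ1]
  have hct : ENNReal.ofReal (1 - γ) ^ (-s) ≠ ∞ := by simp [ENNReal.rpow_eq_top_iff, hγ1]
  have hp0 := natCast_rpow_ne_zero hn (1 + s / d)
  have hpt := natCast_rpow_ne_top hn (1 + s / d)
  rw [← tsub_le_iff_right, mul_comm (ENNReal.ofReal (1 - γ) ^ (-s)),
    ← ENNReal.div_le_iff_le_mul (Or.inl hc0) (Or.inl hct), normalizedRieszEnergy, ENNReal.le_div_iff_mul_le (Or.inl hp0) (Or.inl hpt)]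
  refine le_iInf fun ω => le_iInf fun hω => le_iInf fun hcard => ?_
  rw [← ENNReal.le_div_iff_mul_le (Or.inl hp0) (Or.inl hpt), ENNReal.div_le_iff_le_mul
    (Or.inl hc0) (Or.inl hct), tsub_le_iff_right]
  have hinj : Function.Injective fun x : EuclideanSpace ℝ (Fin d) => (1 - γ) • x :=
    smul_right_injective _ hδ.ne'
  have hcell : ∀ x ∈ ω.image fun x => (1 - γ) • x, cellIndex x = 0 := by
    intro y hy
    obtain ⟨x, hx, rfl⟩ := Finset.mem_image.1 hy
    ext i
    have h1 := hω hx i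
    rw [cellIndex, PiLp.smul_apply, smul_eq_mul, Pi.zero_apply, Int.floor_eq_zero_iff]
    exact ⟨mul_nonneg hδ.le h1.1, by nlinarith [h1.1, h1.2]⟩
  have hne : ω.Nonempty := Finset.card_ne_zero.1 (hcard ▸ hn)
  refine (limsup_mul_volume_rpow_le hd hs hA hcell (hne.image _)).trans ?_
  rw [Finset.card_image_of_injective _ hinj, hcard]
  refine (ENNReal.div_le_div_right (periodicEnergy_image_smul_le hs hγ0 hγ1 hω) _).trans_eq ?_
  have hpow : (n : ℝ≥0∞) ^ (1 + s / d) = (n : ℝ≥0∞) ^ 2 * (n : ℝ≥0∞) ^ (s / d - 1) := by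
    rw [← ENNReal.rpow_natCast, ← ENNReal.rpow_add _ _ (by simpa using hn) (by simp)]
    congr 1
    push_cast
    ring
  rw [ENNReal.add_div, hcard]
  congr 1
  · rw [div_eq_mul_inv, div_eq_mul_inv (rieszEnergy s ω)]
    ring
  · rw [hpow, ENNReal.mul_div_mul_left]
    · simpa using hn
    · simp

theorem minRieszEnergy_unitCube_one : minRieszEnergy s (unitCube d) 1 = 0 := by
  refine le_antisymm ?_ bot_le
  refine (minRieszEnergy_le_of_le_card (ω := {0}) (by simpa using zero_mem_unitCube)
    (by simp)).trans_eq ?_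
  simp [rieszEnergy]

theorem limsup_unitCube_ne_top (hd : d ≠ 0) (hs : (d : ℝ) < s) :
    limsup (normalizedRieszEnergy s (unitCube d)) atTop ≠ ∞ := by
  have hs0 : 0 < s := lt_of_le_of_lt (Nat.cast_nonneg d) hs
  have h := limsup_mul_volume_rpow_le_add hd hs0 isCompact_unitCube (γ := 1 / 2) (by norm_num)
    (by norm_num) one_ne_zero
  rw [normalizedRieszEnergy, minRieszEnergy_unitCube_one, ENNReal.zero_div, mul_zero, zero_add,
    Nat.cast_one, ENNReal.one_rpow, div_one] at h
  intro htop
  rw [htop, ENNReal.top_mul] at h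
  · refine ENNReal.mul_ne_top ?_ (latticeZeta_ne_top hs) (top_le_iff.1 h)
    simp [ENNReal.rpow_eq_top_iff]
  · simp [ENNReal.rpow_eq_zero_iff, volume_unitCube_ne_zero, isCompact_unitCube.measure_lt_top.ne]

theorem liminf_unitCube_ne_top (hd : d ≠ 0) (hs : (d : ℝ) < s) :
    liminf (normalizedRieszEnergy s (unitCube d)) atTop ≠ ∞ :=
  ne_top_of_le_ne_top (limsup_unitCube_ne_top hd hs) liminf_le_limsup

theorem limsup_mul_volume_rpow_le_liminf (hd : d ≠ 0) (hs : (d : ℝ) < s)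
    {A : Set (EuclideanSpace ℝ (Fin d))} (hA : IsCompact A) :
    limsup (normalizedRieszEnergy s A) atTop * volume A ^ (s / d) ≤
      liminf (normalizedRieszEnergy s (unitCube d)) atTop := by
  have hd0 : (0 : ℝ) < d := by positivity
  have hs0 : 0 < s := hd0.trans hs
  have hexp : 0 < s / d - 1 := by rw [sub_pos, one_lt_div hd0]; exact hs
  have hlim : Tendsto (fun γ : ℝ => ENNReal.ofReal (1 - γ) ^ (-s) *
      liminf (normalizedRieszEnergy s (unitCube d)) atTop) (𝓝[>] 0)
      (𝓝 (1 * liminf (normalizedRieszEnergy s (unitCube d)) atTop)) := by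
    refine ENNReal.Tendsto.mul_const ?_ (Or.inl one_ne_zero)
    have hcont : Continuous fun γ : ℝ => ENNReal.ofReal (1 - γ) ^ (-s) :=
      (ENNReal.continuous_rpow_const).comp (ENNReal.continuous_ofReal.comp (by fun_prop))
    simpa using (hcont.tendsto 0).mono_left nhdsWithin_le_nhds
  rw [one_mul] at hlim
  refine ge_of_tendsto hlim ?_
  filter_upwards [Ioo_mem_nhdsGT one_pos] with γ hγ
  refine le_mul_liminf_of_le_mul_add (by simp [ENNReal.rpow_eq_top_iff, hγ.2])
    (tendsto_const_div_natCast_rpow (x := ENNReal.ofReal γ ^ (-s) * latticeZeta d s)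
      (ENNReal.mul_ne_top ?_ (latticeZeta_ne_top hs)) hexp) ?_
  · simp [ENNReal.rpow_eq_top_iff, hγ.1]
  · filter_upwards [eventually_ne_atTop 0] with n hn
    exact limsup_mul_volume_rpow_le_add hd hs0 hA hγ.1 hγ.2 hn

/-- The normalized minimal energies converge; the constant is the lower limit for the cube. -/
theorem tendsto_normalizedRieszEnergy (hd : d ≠ 0) (hs : (d : ℝ) < s)
    {A : Set (EuclideanSpace ℝ (Fin d))} (hA : IsCompact A) :
    Tendsto (normalizedRieszEnergy s A) atTop
      (𝓝 (liminf (normalizedRieszEnergy s (unitCube d)) atTop / volume A ^ (s / d))) := by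
  have hd0 : (0 : ℝ) < d := by positivity
  have hs0 : 0 < s := hd0.trans hs
  have hσ : 0 < s / d := by positivity
  have hC0 := liminf_unitCube_ne_zero hd hs0
  refine tendsto_of_le_liminf_of_limsup_le (liminf_unitCube_div_le_liminf hd hs0 hA) ?_
    (by isBoundedDefault) (by isBoundedDefault)
  rw [ENNReal.le_div_iff_mul_le (Or.inr hC0) (Or.inr (liminf_unitCube_ne_top hd hs))]
  exact limsup_mul_volume_rpow_le_liminf hd hs hA

end Limit

/-- for `s > d` there is a finite positive constant `C = C_{s,d}` such that for
every compact `A ⊆ ℝ^d`, `ℰ_s(A,N)/N^{1+s/d} → C/H_d(A)^{s/d}` in `[0,∞]`. -/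
theorem exists_const_minRieszEnergy_div_tendsto (d : ℕ) (hd : 1 ≤ d) (s : ℝ)
    (hs : (d : ℝ) < s) :
    ∃ C : ℝ, 0 < C ∧ ∀ A : Set (EuclideanSpace ℝ (Fin d)), IsCompact A →
      Tendsto
        (fun N : ℕ => minRieszEnergy s A N / ENNReal.ofReal ((N : ℝ) ^ (1 + s / (d : ℝ))))
        atTop
        (𝓝 (ENNReal.ofReal C / (volume A) ^ (s / (d : ℝ)))) := by
  have hd0 : d ≠ 0 := Nat.one_le_iff_ne_zero.1 hd
  have hs0 : 0 < s := lt_of_le_of_lt (Nat.cast_nonneg d) hs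
  have hp : 0 ≤ 1 + s / (d : ℝ) := by positivity
  have hC0 := liminf_unitCube_ne_zero hd0 hs0
  have hCt := liminf_unitCube_ne_top hd0 hs
  refine ⟨_, ENNReal.toReal_pos hC0 hCt, fun A hA => ?_⟩
  rw [ENNReal.ofReal_toReal hCt]
  refine (tendsto_normalizedRieszEnergy hd0 hs hA).congr fun N => ?_
  rw [normalizedRieszEnergy, ← ENNReal.ofReal_rpow_of_nonneg (Nat.cast_nonneg N) hp,
    ENNReal.ofReal_natCast]
end
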